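/- arXiv:1501.05637 — 5 statements merged into one kernel-verified Lean document; each statement's English description precedes it below -/
import Mathlib

section
/- Let N ≥ 2 be an integer, let λ_1 ≤ λ_2 ≤ … ≤ λ_N be real numbers, let A ⊆ ℝ and let s > 0. Then the number of indices i ∈ {1,…,N−1} with λ_i ∈ A, λ_{i+1} ∈ A and λ_{i+1} − λ_i ≤ s equals the alternating sum Σ_{k=2}^{N} (−1)^k · #{(i_1,…,i_k) : 1 ≤ i_1 < i_2 < … < i_k ≤ N, λ_{i_1} ∈ A, λ_{i_k} ∈ A, λ_{i_k} − λ_{i_1} ≤ s}. -/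
open scoped Classical in
/-- The signed count of the finsets with minimum `i` and maximum `j` vanishes unless `j = i + 1`;
summing over all pairs `(i, j)` satisfying `P` leaves the consecutive pairs. -/
theorem sum_neg_one_pow_card_filter_min'_max' (P : ℕ → ℕ → Prop)
    [DecidablePred fun i => P i (i + 1)] (N : ℕ) :
    ∑ T ∈ (Finset.Icc 1 N).powerset with
        2 ≤ T.card ∧ ∃ hT : T.Nonempty, P (T.min' hT) (T.max' hT), (-1 : ℤ) ^ T.card
      = (((Finset.Icc 1 (N - 1)).filter fun i => P i (i + 1)).card : ℤ) := by
  have min'_eq (i j : ℕ) (S : Finset ℕ) (hij : i < j) (hS : S ⊆ Finset.Ioo i j)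
      (h : (insert i (insert j S)).Nonempty) : (insert i (insert j S)).min' h = i := by
    refine le_antisymm (Finset.min'_le _ _ (by simp)) (Finset.le_min' _ _ _ fun x hx => ?_)
    have := @hS x
    grind
  have max'_eq (i j : ℕ) (S : Finset ℕ) (hij : i < j) (hS : S ⊆ Finset.Ioo i j)
      (h : (insert i (insert j S)).Nonempty) : (insert i (insert j S)).max' h = j := by
    refine le_antisymm (Finset.max'_le _ _ _ fun x hx => ?_) (Finset.le_max' _ _ (by simp))
    have := @hS x
    grind
  have card_eq (i j : ℕ) (S : Finset ℕ) (hij : i < j) (hS : S ⊆ Finset.Ioo i j) :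
      (insert i (insert j S)).card = S.card + 2 := by
    have hi := @hS i
    have hj := @hS j
    rw [Finset.card_insert_of_notMem (by grind), Finset.card_insert_of_notMem (by grind)]
  let pairs := (Finset.Icc 1 N ×ˢ Finset.Icc 1 N).filter fun p => p.1 < p.2 ∧ P p.1 p.2
  have hbij : ∑ x ∈ pairs.sigma fun p => (Finset.Ioo p.1 p.2).powerset, (-1 : ℤ) ^ x.2.card
      = ∑ T ∈ (Finset.Icc 1 N).powerset with
        2 ≤ T.card ∧ ∃ hT : T.Nonempty, P (T.min' hT) (T.max' hT), (-1 : ℤ) ^ T.card := by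
    refine Finset.sum_bij (fun x _ => insert x.1.1 (insert x.1.2 x.2)) ?_ ?_ ?_ ?_
    · rintro ⟨⟨i, j⟩, S⟩ hx
      simp only [pairs, Finset.mem_sigma, Finset.mem_filter, Finset.mem_product, Finset.mem_Icc,
        Finset.mem_powerset] at hx ⊢
      obtain ⟨⟨⟨hi, hj⟩, hij, hP⟩, hS⟩ := hx
      refine ⟨fun x hx => ?_, by rw [card_eq i j S hij hS]; omega,
        Finset.insert_nonempty _ _, ?_⟩
      · have := @hS x
        grind
      · rwa [min'_eq i j S hij hS, max'_eq i j S hij hS]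
    · rintro ⟨⟨i, j⟩, S⟩ hx ⟨⟨i', j'⟩, S'⟩ hx' h
      simp only [pairs, Finset.mem_sigma, Finset.mem_filter, Finset.mem_product, Finset.mem_Icc,
        Finset.mem_powerset] at hx hx' h
      obtain ⟨-, hij, -⟩ := hx.1
      obtain ⟨-, hij', -⟩ := hx'.1
      have hi : i = i' := by
        rw [← min'_eq i j S hij hx.2 (Finset.insert_nonempty _ _),
          ← min'_eq i' j' S' hij' hx'.2 (Finset.insert_nonempty _ _)]
        simp only [h]
      have hj : j = j' := by
        rw [← max'_eq i j S hij hx.2 (Finset.insert_nonempty _ _),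
          ← max'_eq i' j' S' hij' hx'.2 (Finset.insert_nonempty _ _)]
        simp only [h]
      subst hi hj
      have hS : S = S' := by
        ext x
        have h1 := @hx.2 x
        have h2 := @hx'.2 x
        have h3 := Finset.ext_iff.mp h x
        grind
      rw [hS]
    · intro T hT
      simp only [Finset.mem_filter, Finset.mem_powerset] at hT
      obtain ⟨hTN, hcard, hne, hP⟩ := hT
      have hlt : T.min' hne < T.max' hne := Finset.min'_lt_max'_of_card T (by omega)
      have hmin := Finset.min'_mem T hne
      have hmax := Finset.max'_mem T hne
      refine ⟨⟨(T.min' hne, T.max' hne), T ∩ Finset.Ioo (T.min' hne) (T.max' hne)⟩, ?_, ?_⟩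
      · simp only [pairs, Finset.mem_sigma, Finset.mem_filter, Finset.mem_product,
          Finset.mem_powerset]
        exact ⟨⟨⟨hTN hmin, hTN hmax⟩, hlt, hP⟩, Finset.inter_subset_right⟩
      · ext x
        have h1 := T.min'_le x
        have h2 := T.le_max' x
        grind
    · rintro ⟨⟨i, j⟩, S⟩ hx
      simp only [pairs, Finset.mem_sigma, Finset.mem_filter, Finset.mem_powerset] at hx
      rw [card_eq i j S hx.1.2.1 hx.2, pow_add]
      simp
  rw [← hbij, Finset.sum_sigma]
  simp only [Finset.sum_powerset_neg_one_pow_card]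
  rw [← Finset.sum_filter, Finset.sum_const, nsmul_eq_mul, mul_one, Nat.cast_inj]
  refine Finset.card_bij (fun p _ => p.1) ?_ ?_ ?_
  all_goals simp only [pairs, Finset.mem_filter, Finset.mem_product, Finset.mem_Icc,
    Finset.ext_iff, Finset.mem_Ioo, Finset.notMem_empty, iff_false]
  · rintro ⟨i, j⟩ ⟨⟨⟨hi, hj⟩, hij, hP⟩, hempty⟩
    have := hempty (i + 1)
    obtain rfl : j = i + 1 := by grind
    exact ⟨by grind, hP⟩
  · rintro ⟨i, j⟩ ⟨⟨⟨hi, hj⟩, hij, hP⟩, hempty⟩ ⟨i', j'⟩ ⟨⟨⟨hi', hj'⟩, hij', hP'⟩, hempty'⟩ h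
    have h1 := hempty (i + 1)
    have h2 := hempty' (i' + 1)
    grind
  · rintro i ⟨hi, hP⟩
    exact ⟨(i, i + 1), ⟨⟨⟨by grind, by grind⟩, by grind, hP⟩, by grind⟩, rfl⟩


/-- For a nondecreasing finite sequence `lam 1 ≤ … ≤ lam N` (N ≥ 2),
a set `A ⊆ ℝ` and `s > 0`, the number of indices `i ∈ {1,…,N−1}` with
`lam i ∈ A`, `lam (i+1) ∈ A` and `lam (i+1) − lam i ≤ s` equals the alternating sum
`Σ_{k=2}^{N} (−1)^k · #{chains i₁ < … < i_k in {1,…,N} with lam i₁ ∈ A, lam i_k ∈ A,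
lam i_k − lam i₁ ≤ s}` (chains are encoded as finsets `T ⊆ {1,…,N}` of cardinality `k`,
with `i₁ = min T`, `i_k = max T`). -/
theorem spacing_inclusion_exclusion
    (N : ℕ) (hN : 2 ≤ N) (lam : ℕ → ℝ)
    (hmono : ∀ i j, 1 ≤ i → i ≤ j → j ≤ N → lam i ≤ lam j)
    (A : Set ℝ) (s : ℝ) (hs : 0 < s) :
    (Set.ncard {i : ℕ | 1 ≤ i ∧ i ≤ N - 1 ∧ lam i ∈ A ∧ lam (i + 1) ∈ A ∧
        lam (i + 1) - lam i ≤ s} : ℤ)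
      = ∑ k ∈ Finset.Icc 2 N, (-1 : ℤ) ^ k *
          (Set.ncard {T : Finset ℕ | T ⊆ Finset.Icc 1 N ∧ T.card = k ∧
            ∃ hT : T.Nonempty, lam (T.min' hT) ∈ A ∧ lam (T.max' hT) ∈ A ∧
              lam (T.max' hT) - lam (T.min' hT) ≤ s} : ℤ) := by
  classical
  let P : ℕ → ℕ → Prop := fun i j => lam i ∈ A ∧ lam j ∈ A ∧ lam j - lam i ≤ s
  have hleft : {i : ℕ | 1 ≤ i ∧ i ≤ N - 1 ∧ lam i ∈ A ∧ lam (i + 1) ∈ A ∧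
      lam (i + 1) - lam i ≤ s} = ((Finset.Icc 1 (N - 1)).filter fun i => P i (i + 1)) := by
    ext i
    simp [P, and_assoc]
  rw [hleft, Set.ncard_coe_finset, ← sum_neg_one_pow_card_filter_min'_max' P N,
    ← Finset.sum_fiberwise_of_maps_to (t := Finset.Icc 2 N) (g := Finset.card)]
  · refine Finset.sum_congr rfl fun k hk => ?_
    rw [Finset.sum_congr rfl (g := fun _ => (-1 : ℤ) ^ k) fun T hT => by
        rw [(Finset.mem_filter.mp hT).2],
      Finset.sum_const, nsmul_eq_mul, mul_comm, ← Set.ncard_coe_finset]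
    congr 3
    ext T
    simp only [P, Finset.coe_filter, Finset.mem_filter, Finset.mem_powerset, Set.mem_ofPred_eq]
    have := (Finset.mem_Icc.mp hk).1
    constructor
    · rintro ⟨⟨h1, -, h2⟩, h3⟩
      exact ⟨h1, h3, h2⟩
    · rintro ⟨h1, h3, h2⟩
      exact ⟨⟨h1, by omega, h2⟩, h3⟩
  · intro T hT
    simp only [Finset.mem_filter, Finset.mem_powerset] at hT
    have := Finset.card_le_card hT.1
    simp only [Nat.card_Icc] at this
    exact Finset.mem_Icc.mpr ⟨hT.2.1, by omega⟩
end

section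
/- Let N ≥ 2 be an integer, let λ_1 ≤ λ_2 ≤ … ≤ λ_N be real numbers, let A ⊆ ℝ, let s > 0, and let m be an integer with 2 ≤ m ≤ N. Writing σ(s) := #{i ∈ {1,…,N−1} : λ_i ∈ A, λ_{i+1} ∈ A, λ_{i+1} − λ_i ≤ s} and γ_k(s) := #{(i_1,…,i_k) : 1 ≤ i_1 < … < i_k ≤ N, λ_{i_1} ∈ A, λ_{i_k} ∈ A, λ_{i_k} − λ_{i_1} ≤ s}, one has the Bonferroni-type inequality (−1)^m · σ(s) ≤ (−1)^m · Σ_{k=2}^{m} (−1)^k γ_k(s). In particular the partial alternating sums over-estimate σ(s) when m is even and under-estimate it when m is odd. -/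
/-- Finite sets of naturals in `[1, N]` with `k + 2` elements whose extreme elements are related
by `r`, counted according to their extreme elements. -/
theorem ncard_finset_extremes_rel (N k : ℕ) (r : ℕ → ℕ → Prop) [DecidableRel r] :
    Set.ncard {T : Finset ℕ | T ⊆ Finset.Icc 1 N ∧ T.card = k + 2 ∧
      ∃ hT : T.Nonempty, r (T.min' hT) (T.max' hT)} =
    ∑ p ∈ Finset.Icc 1 N ×ˢ Finset.Icc 1 N with p.1 < p.2 ∧ r p.1 p.2,
      (p.2 - p.1 - 1).choose k := by
  set P := {p ∈ Finset.Icc 1 N ×ˢ Finset.Icc 1 N | p.1 < p.2 ∧ r p.1 p.2} with hP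
  let S : Finset (Σ _ : ℕ × ℕ, Finset ℕ) :=
    P.sigma fun p => (Finset.Ioo p.1 p.2).powersetCard k
  let f : (Σ _ : ℕ × ℕ, Finset ℕ) → Finset ℕ := fun x => insert x.1.1 (insert x.1.2 x.2)
  have hS : ∀ x ∈ S, (1 ≤ x.1.1 ∧ x.1.2 ≤ N ∧ x.1.1 < x.1.2 ∧ r x.1.1 x.1.2) ∧
      (∀ u ∈ x.2, x.1.1 < u ∧ u < x.1.2) ∧ x.2.card = k := by
    intro x hx
    simp only [S, hP, Finset.mem_sigma, Finset.mem_filter, Finset.mem_product, Finset.mem_Icc,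
      Finset.mem_powersetCard] at hx
    exact ⟨by tauto, fun u hu => Finset.mem_Ioo.1 (hx.2.1 hu), hx.2.2⟩
  have hne : ∀ x, (f x).Nonempty := fun x => Finset.insert_nonempty _ _
  have hmin : ∀ x ∈ S, (f x).min' (hne x) = x.1.1 := by
    intro x hx
    obtain ⟨⟨-, -, h, -⟩, hU, -⟩ := hS x hx
    refine le_antisymm (Finset.min'_le _ _ (by simp [f])) (Finset.le_min' _ _ _ fun y hy => ?_)
    simp only [f, Finset.mem_insert] at hy
    grind
  have hmax : ∀ x ∈ S, (f x).max' (hne x) = x.1.2 := by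
    intro x hx
    obtain ⟨⟨-, -, h, -⟩, hU, -⟩ := hS x hx
    refine le_antisymm (Finset.max'_le _ _ _ fun y hy => ?_) (Finset.le_max' _ _ (by simp [f]))
    simp only [f, Finset.mem_insert] at hy
    grind
  have hinj : Set.InjOn f S := by
    intro x hx y hy hxy
    have h1 : x.1.1 = y.1.1 := by
      rw [← hmin x hx, ← hmin y hy]; simp only [hxy]
    have h2 : x.1.2 = y.1.2 := by
      rw [← hmax x hx, ← hmax y hy]; simp only [hxy]
    have hxU := (hS x hx).2.1
    have hyU := (hS y hy).2.1
    have h3 : x.2 = y.2 := by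
      ext u
      have := Finset.ext_iff.1 hxy u
      simp only [f, Finset.mem_insert] at this
      grind
    exact Sigma.ext (Prod.ext h1 h2) (heq_of_eq h3)
  have himg : {T : Finset ℕ | T ⊆ Finset.Icc 1 N ∧ T.card = k + 2 ∧
      ∃ hT : T.Nonempty, r (T.min' hT) (T.max' hT)} = f '' S := by
    ext T
    constructor
    · rintro ⟨hsub, hcard, hT, hr⟩
      have hlt : T.min' hT < T.max' hT := Finset.min'_lt_max'_of_card _ (by omega)
      have hi := T.min'_mem hT
      have hj := T.max'_mem hT
      have hle : ∀ u ∈ T, T.min' hT ≤ u ∧ u ≤ T.max' hT :=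
        fun u hu => ⟨T.min'_le u hu, T.le_max' u hu⟩
      refine ⟨⟨(T.min' hT, T.max' hT), (T.erase (T.min' hT)).erase (T.max' hT)⟩, ?_, ?_⟩
      · have hj' : T.max' hT ∈ T.erase (T.min' hT) := Finset.mem_erase.2 ⟨hlt.ne', hj⟩
        simp only [S, hP, Finset.coe_sigma, Set.mem_sigma_iff, Finset.mem_coe, Finset.mem_filter,
          Finset.mem_product, Finset.mem_powersetCard]
        refine ⟨⟨⟨hsub hi, hsub hj⟩, hlt, hr⟩, fun u hu => ?_, ?_⟩
        · simp only [Finset.mem_erase] at hu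
          have := hle u hu.2.2
          rw [Finset.mem_Ioo]
          omega
        · rw [Finset.card_erase_of_mem hj', Finset.card_erase_of_mem hi, hcard]
          omega
      · have hj' : T.max' hT ∈ T.erase (T.min' hT) := Finset.mem_erase.2 ⟨hlt.ne', hj⟩
        simp only [f]
        rw [Finset.insert_erase hj', Finset.insert_erase hi]
    · rintro ⟨x, hx, rfl⟩
      obtain ⟨⟨h1, hN, h, hr⟩, hU, hc⟩ := hS x hx
      refine ⟨fun y hy => ?_, ?_, hne x, ?_⟩
      · simp only [f, Finset.mem_insert] at hy
        rw [Finset.mem_Icc]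
        grind
      · have h2 : x.1.2 ∉ x.2 := fun hm => (hU _ hm).2.false
        have h1 : x.1.1 ∉ insert x.1.2 x.2 := by
          rw [Finset.mem_insert]
          rintro (he | hm)
          · omega
          · exact (hU _ hm).1.false
        simp only [f]
        rw [Finset.card_insert_of_notMem h1, Finset.card_insert_of_notMem h2, hc]
      · rw [hmin x hx, hmax x hx]
        exact hr
  rw [himg, hinj.ncard_image, Set.ncard_coe_finset, Finset.card_sigma]
  simp

/-- Nearest-neighbour pairs related by `r`, counted inside the pairs `i < j`. -/
theorem ncard_adjacent_rel (N : ℕ) (r : ℕ → ℕ → Prop) [DecidableRel r] :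
    Set.ncard {i : ℕ | 1 ≤ i ∧ i ≤ N - 1 ∧ r i (i + 1)} =
    ∑ p ∈ Finset.Icc 1 N ×ˢ Finset.Icc 1 N with p.1 < p.2 ∧ r p.1 p.2,
      if p.2 = p.1 + 1 then 1 else 0 := by
  rw [← Finset.card_filter, ← Set.ncard_coe_finset]
  refine Set.ncard_congr (fun i _ => (i, i + 1)) ?_ ?_ ?_
  · rintro i ⟨h1, h2, h3⟩
    simp only [Finset.coe_filter, Finset.mem_filter, Finset.mem_product, Finset.mem_Icc,
      Set.mem_ofPred_eq]
    exact ⟨⟨by omega, by omega, h3⟩, trivial⟩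
  · intro i j _ _ h
    exact (Prod.ext_iff.1 h).1
  · rintro ⟨i, j⟩ h
    simp only [Finset.coe_filter, Finset.mem_filter, Finset.mem_product, Finset.mem_Icc,
      Set.mem_ofPred_eq] at h
    obtain ⟨⟨h1, h2, h3⟩, rfl⟩ := h
    exact ⟨i, ⟨by omega, by omega, h3⟩, rfl⟩

/-- Bonferroni inequality for the truncated alternating sums of a row of Pascal's triangle. -/
theorem neg_one_pow_mul_ite_le_alternating_sum_choose (d n : ℕ) :
    (-1 : ℤ) ^ n * (if d = 0 then 1 else 0) ≤
      (-1 : ℤ) ^ n * ∑ k ∈ Finset.range (n + 1), (-1 : ℤ) ^ k * (d.choose k : ℤ) := by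
  rcases d with _ | d
  · rw [Finset.sum_range_succ']
    simp
  · have h : ∑ k ∈ Finset.range (n + 1), (-1 : ℤ) ^ k * ((d + 1).choose k : ℤ) =
        (-1) ^ n * (d.choose n : ℤ) := Int.alternating_sum_range_choose_eq_choose
    rw [h, ← mul_assoc, ← mul_pow]
    simp

/-- Bonferroni-type inequality: with `σ(s)` the number of nearest-neighbour
spacings `≤ s` localized to `A` and `γ_k(s)` the number of `k`-chains `i₁ < … < i_k`
(encoded as finsets `T ⊆ {1,…,N}` with `|T| = k`) whose extreme `lam`-values lie in `A`
and differ by at most `s`, for every `2 ≤ m ≤ N` one has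
`(−1)^m σ(s) ≤ (−1)^m Σ_{k=2}^m (−1)^k γ_k(s)`. -/
theorem spacing_bonferroni
    (N : ℕ) (hN : 2 ≤ N) (lam : ℕ → ℝ)
    (hmono : ∀ i j, 1 ≤ i → i ≤ j → j ≤ N → lam i ≤ lam j)
    (A : Set ℝ) (s : ℝ) (hs : 0 < s) (m : ℕ) (hm2 : 2 ≤ m) (hmN : m ≤ N) :
    (-1 : ℤ) ^ m *
      (Set.ncard {i : ℕ | 1 ≤ i ∧ i ≤ N - 1 ∧ lam i ∈ A ∧ lam (i + 1) ∈ A ∧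
        lam (i + 1) - lam i ≤ s} : ℤ)
      ≤ (-1 : ℤ) ^ m * ∑ k ∈ Finset.Icc 2 m, (-1 : ℤ) ^ k *
          (Set.ncard {T : Finset ℕ | T ⊆ Finset.Icc 1 N ∧ T.card = k ∧
            ∃ hT : T.Nonempty, lam (T.min' hT) ∈ A ∧ lam (T.max' hT) ∈ A ∧
              lam (T.max' hT) - lam (T.min' hT) ≤ s} : ℤ) := by
  classical
  obtain ⟨n, rfl⟩ := Nat.exists_eq_add_of_le' hm2
  let r : ℕ → ℕ → Prop := fun i j => lam i ∈ A ∧ lam j ∈ A ∧ lam j - lam i ≤ s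
  have hsum : ∀ g : ℕ → ℤ, ∑ k ∈ Finset.Icc 2 (n + 2), g k =
      ∑ k ∈ Finset.range (n + 1), g (k + 2) := by
    intro g
    rw [Finset.range_eq_Ico, Finset.sum_Ico_add' g 0 (n + 1) 2]
    rfl
  have hsign : ∀ k, (-1 : ℤ) ^ (k + 2) = (-1) ^ k := fun k => by ring
  rw [hsum, show Set.ncard {i : ℕ | 1 ≤ i ∧ i ≤ N - 1 ∧ lam i ∈ A ∧ lam (i + 1) ∈ A ∧
    lam (i + 1) - lam i ≤ s} = _ from ncard_adjacent_rel N r]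
  simp only [fun k => show Set.ncard {T : Finset ℕ | T ⊆ Finset.Icc 1 N ∧ T.card = k + 2 ∧
    ∃ hT : T.Nonempty, lam (T.min' hT) ∈ A ∧ lam (T.max' hT) ∈ A ∧
      lam (T.max' hT) - lam (T.min' hT) ≤ s} = _ from ncard_finset_extremes_rel N k r, hsign]
  push_cast
  simp only [Finset.mul_sum (s := Finset.filter _ _)]
  rw [Finset.sum_comm, Finset.mul_sum]
  refine Finset.sum_le_sum fun p hp => ?_
  have hlt : p.1 < p.2 := (Finset.mem_filter.1 hp).2.1
  have hiff : p.2 = p.1 + 1 ↔ p.2 - p.1 - 1 = 0 := by omega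
  simp only [hiff]
  exact neg_one_pow_mul_ite_le_alternating_sum_choose _ n
end

section
/- For every positive integer k, the sum over all set partitions P of {1,…,k} of the product Π_{B ∈ P} |B|! (the product of the factorials of the block sizes) is at most 4^k · k!. -/
namespace Finpartition

variable {α : Type*} [DecidableEq α] {s : Finset α}

theorem parts_avoid_of_mem (P : Finpartition s) {B : Finset α} (hB : B ∈ P.parts) :
    (P.avoid B).parts = P.parts.erase B := by
  have sdiff_eq {d : Finset α} (hd : d ∈ P.parts) (hne : d ≠ B) : d \ B = d :=
    Finset.sdiff_eq_self_of_disjoint (P.disjoint hd hB hne)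
  ext c
  rw [mem_avoid, Finset.mem_erase]
  constructor
  · rintro ⟨d, hd, hle, rfl⟩
    have hne : d ≠ B := fun h => hle h.le
    rw [sdiff_eq hd hne]
    exact ⟨hne, hd⟩
  · rintro ⟨hne, hc⟩
    refine ⟨c, hc, fun hle => ?_, sdiff_eq hc hne⟩
    exact P.ne_bot hc ((P.disjoint hc hB hne).eq_bot_of_le hle)

theorem sum_filter_part_le_sum_sdiff (f : Finset α → ℕ) {a : α} (ha : a ∈ s) (B : Finset α) :
    ∑ P : Finpartition s with P.part a = B, ∏ C ∈ P.parts, f C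
      ≤ f B * ∑ Q : Finpartition (s \ B), ∏ C ∈ Q.parts, f C := by
  have hmem {P : Finpartition s} (hP : P.part a = B) : B ∈ P.parts := hP ▸ P.part_mem.2 ha
  have hinj : Set.InjOn (fun P : Finpartition s => P.avoid B)
      (Finset.univ.filter fun P : Finpartition s => P.part a = B) := by
    intro P hP Q hQ h
    have hP' := hmem (by simpa using hP)
    have hQ' := hmem (by simpa using hQ)
    have h' := congrArg Finpartition.parts h
    simp only [parts_avoid_of_mem _ hP', parts_avoid_of_mem _ hQ'] at h'
    ext1
    rw [← Finset.insert_erase hP', h', Finset.insert_erase hQ']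
  calc ∑ P : Finpartition s with P.part a = B, ∏ C ∈ P.parts, f C
      = ∑ P : Finpartition s with P.part a = B, f B * ∏ C ∈ (P.avoid B).parts, f C := by
        refine Finset.sum_congr rfl fun P hP => ?_
        have hP' := hmem (Finset.mem_filter.1 hP).2
        rw [parts_avoid_of_mem P hP', Finset.mul_prod_erase _ _ hP']
    _ = f B * ∑ Q ∈ (Finset.univ.filter fun P : Finpartition s => P.part a = B).image
          (fun P => P.avoid B), ∏ C ∈ Q.parts, f C := by
        rw [Finset.sum_image hinj, Finset.mul_sum]
    _ ≤ _ := Nat.mul_le_mul_left _ (Finset.sum_le_sum_of_subset (Finset.subset_univ _))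

theorem sum_prod_le_sum_powerset_erase (f : Finset α → ℕ) {a : α} (ha : a ∈ s) :
    ∑ P : Finpartition s, ∏ C ∈ P.parts, f C
      ≤ ∑ T ∈ (s.erase a).powerset,
          f (insert a T) * ∑ Q : Finpartition (s \ insert a T), ∏ C ∈ Q.parts, f C := by
  have hmaps : ∀ P ∈ (Finset.univ : Finset (Finpartition s)),
      (P.part a).erase a ∈ (s.erase a).powerset := fun P _ =>
    Finset.mem_powerset.2 (Finset.erase_subset_erase a (P.part_subset a))
  rw [← Finset.sum_fiberwise_of_maps_to hmaps]
  refine Finset.sum_le_sum fun T _ => ?_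
  refine le_trans (Finset.sum_le_sum_of_subset fun P hP => ?_)
    (sum_filter_part_le_sum_sdiff f ha (insert a T))
  rw [Finset.mem_filter] at hP ⊢
  exact ⟨hP.1, by rw [← hP.2, Finset.insert_erase (P.mem_part_self.2 ha)]⟩

end Finpartition

theorem Nat.sum_choose_mul_factorial_mul_two_pow_le (n : ℕ) :
    ∑ m ∈ Finset.range (n + 1),
        n.choose m * ((m + 1).factorial * (2 ^ (n - m) * (n - m).factorial))
      ≤ 2 ^ (n + 1) * (n + 1).factorial := by
  calc _ ≤ ∑ m ∈ Finset.range (n + 1), (n + 1).factorial * 2 ^ (n - m) := by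
        refine Finset.sum_le_sum fun m hm => ?_
        have hmn : m ≤ n := Nat.lt_succ_iff.1 (Finset.mem_range.1 hm)
        calc _ = (m + 1) * (n.choose m * m.factorial * (n - m).factorial) * 2 ^ (n - m) := by
              rw [Nat.factorial_succ]; ring
          _ ≤ _ := by
              rw [Nat.choose_mul_factorial_mul_factorial hmn, Nat.factorial_succ]
              gcongr
    _ = (n + 1).factorial * ∑ m ∈ Finset.range (n + 1), 2 ^ m := by
        rw [← Finset.mul_sum, ← Finset.sum_range_reflect (fun m => 2 ^ m)]
        simp
    _ ≤ _ := by
        rw [mul_comm]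
        exact Nat.mul_le_mul_right _ (Nat.geomSum_lt le_rfl fun m hm => Finset.mem_range.1 hm).le

theorem Finpartition.sum_prod_factorial_card_le {α : Type*} [DecidableEq α] (s : Finset α) :
    ∑ P : Finpartition s, ∏ B ∈ P.parts, B.card.factorial ≤ 2 ^ s.card * s.card.factorial := by
  induction s using Finset.strongInduction with
  | H s ih =>
    obtain rfl | ⟨a, ha⟩ := s.eq_empty_or_nonempty
    · have hparts (P : Finpartition (∅ : Finset α)) : P.parts = ∅ := P.parts_eq_empty_iff.2 rfl
      have : Subsingleton (Finpartition (∅ : Finset α)) :=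
        ⟨fun P Q => Finpartition.ext ((hparts P).trans (hparts Q).symm)⟩
      simpa [hparts] using Fintype.card_le_one_iff_subsingleton.2 this
    · have hcard : s.card = (s.erase a).card + 1 := (Finset.card_erase_add_one ha).symm
      refine (sum_prod_le_sum_powerset_erase (fun B => B.card.factorial) ha).trans ?_
      rw [hcard]
      refine le_trans (Finset.sum_le_sum fun T hT => ?_) ((Finset.sum_powerset_apply_card
        (fun m => (m + 1).factorial *
          (2 ^ ((s.erase a).card - m) * ((s.erase a).card - m).factorial))).trans_le
        (by simpa only [smul_eq_mul] using
          Nat.sum_choose_mul_factorial_mul_two_pow_le (s.erase a).card))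
      rw [Finset.mem_powerset] at hT
      have haT : a ∉ T := fun h => Finset.notMem_erase a s (hT h)
      have hsub : insert a T ⊆ s :=
        Finset.insert_subset ha (hT.trans (Finset.erase_subset a s))
      have hsdiff : (s \ insert a T).card = (s.erase a).card - T.card := by
        rw [Finset.card_sdiff_of_subset hsub, Finset.card_insert_of_notMem haT, hcard]
        omega
      simp only [Finset.card_insert_of_notMem haT, ← hsdiff]
      exact Nat.mul_le_mul_left _
        (ih _ (Finset.sdiff_ssubset hsub (Finset.insert_nonempty a T)))

/-- For every positive integer `k`, the sum over all set partitions `P` of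
`{1,…,k}` of the product of the factorials of the block sizes is at most `4^k · k!`. -/
theorem sum_partitions_prod_factorials_le (k : ℕ) (hk : 0 < k) :
    ∑ P : Finpartition (Finset.univ : Finset (Fin k)),
        ∏ B ∈ P.parts, (B.card).factorial
      ≤ 4 ^ k * k.factorial := by
  have h := Finpartition.sum_prod_factorial_card_le (Finset.univ : Finset (Fin k))
  rw [Finset.card_univ, Fintype.card_fin] at h
  exact h.trans (Nat.mul_le_mul_right _ (Nat.pow_le_pow_left (by norm_num) k))
end

section
/- Let I₄(x,y) = ∫_0^{x−y} K₂(2t,0) dt and for u,v ∈ ℝ define ℛ_{u,v}(x,y) = I₄(x+u, y+v) − 1/4 if y < x, and ℛ_{u,v}(x,y) = I₄(x+u, y+v) + 1/4 if y ≥ x. There exists a constant C > 0 such that for every α > 0, all u,v ∈ [−α,α] and every y ∈ ℝ: ∫_ℝ ( ℛ_{u,v}(x,y) )² dx ≤ C · max(1,α). -/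
open MeasureTheory

/-- The sine kernel `K₂(x,y) = sin(π(x−y))/(π(x−y))` for `x ≠ y`, `K₂(x,x) = 1`. -/
noncomputable def sineKernel (x y : ℝ) : ℝ :=
  if x = y then 1 else Real.sin (Real.pi * (x - y)) / (Real.pi * (x - y))

/-- `I₄(x,y) = ∫_0^{x−y} K₂(2t,0) dt`, the (2,1)-entry of the limiting matrix kernel
`K₄` for symplectic (β = 4) invariant ensembles. -/
noncomputable def I4 (x y : ℝ) : ℝ := ∫ t in (0 : ℝ)..(x - y), sineKernel (2 * t) 0

/-- `ℛ_{u,v}(x,y) = I₄(x+u,y+v) − ¼` if `y < x` and `= I₄(x+u,y+v) + ¼` if `y ≥ x`: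
the integrable part of `I₄`, obtained by subtracting its singular jump `±¼`. -/
noncomputable def Rker (u v x y : ℝ) : ℝ :=
  if y < x then I4 (x + u) (y + v) - 1 / 4 else I4 (x + u) (y + v) + 1 / 4

open scoped Topology

/-- The integrand of the Laplace-type representation of the tail `∫_z^∞ sinc`. -/
noncomputable def sincTailIntegrand (z t : ℝ) : ℝ :=
  Real.exp (-z * t) * (Real.cos z + t * Real.sin z) * (1 + t ^ 2)⁻¹

theorem continuous_sincTailIntegrand (z : ℝ) : Continuous (sincTailIntegrand z) := by
  unfold sincTailIntegrand
  have h : ∀ t : ℝ, 1 + t ^ 2 ≠ 0 := fun t => by positivity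
  fun_prop (disch := exact h _)

theorem hasDerivAt_sincTailIntegrand (z t : ℝ) :
    HasDerivAt (fun z => sincTailIntegrand z t) (-(Real.exp (-z * t) * Real.sin z)) z := by
  have h1 : HasDerivAt (fun z : ℝ => Real.exp (-z * t)) (Real.exp (-z * t) * (-1 * t)) z :=
    ((hasDerivAt_id z).neg.mul_const t).exp
  have h2 : HasDerivAt (fun z : ℝ => Real.cos z + t * Real.sin z)
      (-Real.sin z + t * Real.cos z) z :=
    (Real.hasDerivAt_cos z).add ((Real.hasDerivAt_sin z).const_mul t)
  have ht : 1 + t ^ 2 ≠ 0 := by positivity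
  refine ((h1.mul h2).mul_const (1 + t ^ 2)⁻¹).congr_deriv ?_
  field_simp
  ring

theorem abs_sincTailIntegrand_le_exp (z t : ℝ) :
    |sincTailIntegrand z t| ≤ Real.exp (-z * t) := by
  have ht : 0 < 1 + t ^ 2 := by positivity
  rw [sincTailIntegrand, abs_mul, abs_mul, Real.abs_exp, abs_of_pos (inv_pos.2 ht), mul_assoc]
  refine mul_le_of_le_one_right (Real.exp_pos _).le ?_
  rw [← div_eq_mul_inv, div_le_one ht]
  refine abs_le_of_sq_le_sq ?_ ht.le
  nlinarith [Real.sin_sq_add_cos_sq z, sq_nonneg (Real.sin z - t * Real.cos z),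
    sq_nonneg t, sq_nonneg (t ^ 2)]

theorem abs_sincTailIntegrand_le_inv_one_add_sq {z t : ℝ} (hz : 0 ≤ z) (ht : 0 ≤ t) :
    |sincTailIntegrand z t| ≤ 2 * (1 + t ^ 2)⁻¹ := by
  have hp : 0 < 1 + t ^ 2 := by positivity
  rw [sincTailIntegrand, abs_mul, abs_of_pos (inv_pos.2 hp)]
  refine mul_le_mul_of_nonneg_right ?_ (inv_pos.2 hp).le
  have hzt : 0 ≤ z * t := mul_nonneg hz ht
  have hsin : |t * Real.sin z| ≤ z * t := by
    rw [abs_mul, abs_of_nonneg ht, mul_comm z]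
    refine mul_le_mul_of_nonneg_left ?_ ht
    simpa [abs_of_nonneg hz] using Real.abs_sin_le_abs (x := z)
  have hsum : |Real.cos z + t * Real.sin z| ≤ 1 + z * t :=
    (abs_add_le _ _).trans (add_le_add (Real.abs_cos_le_one z) hsin)
  have hexp : 1 + z * t ≤ Real.exp (z * t) := by linarith [Real.add_one_le_exp (z * t)]
  rw [abs_mul, Real.abs_exp]
  calc Real.exp (-z * t) * |Real.cos z + t * Real.sin z|
      ≤ Real.exp (-z * t) * Real.exp (z * t) :=
        mul_le_mul_of_nonneg_left (hsum.trans hexp) (Real.exp_pos _).le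
    _ = 1 := by rw [← Real.exp_add]; simp
    _ ≤ 2 := by norm_num

/-- The tail of the Dirichlet integral, written as a Laplace-type integral. -/
noncomputable def sincTail (z : ℝ) : ℝ := ∫ t in Set.Ioi (0 : ℝ), sincTailIntegrand z t

theorem integral_exp_neg_mul_Ioi_zero {z : ℝ} (hz : 0 < z) :
    ∫ t in Set.Ioi (0 : ℝ), Real.exp (-z * t) = z⁻¹ := by
  rw [integral_exp_mul_Ioi (neg_lt_zero.2 hz)]
  simp [div_neg, neg_div]

theorem abs_sincTail_le {z : ℝ} (hz : 0 < z) : |sincTail z| ≤ z⁻¹ := by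
  rw [← integral_exp_neg_mul_Ioi_zero hz, ← Real.norm_eq_abs]
  exact norm_integral_le_of_norm_le (integrableOn_exp_mul_Ioi (neg_lt_zero.2 hz) 0)
    (Filter.Eventually.of_forall fun t => abs_sincTailIntegrand_le_exp z t)

theorem hasDerivAt_sincTail {z : ℝ} (hz : 0 < z) :
    HasDerivAt sincTail (-Real.sinc z) z := by
  have hmem : Set.Ioi (z / 2) ∈ 𝓝 z := Ioi_mem_nhds (by linarith)
  have h := (hasDerivAt_integral_of_dominated_loc_of_deriv_le
    (μ := volume.restrict (Set.Ioi (0 : ℝ))) (F := sincTailIntegrand)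
    (F' := fun z t => -(Real.exp (-z * t) * Real.sin z))
    (bound := fun t => Real.exp (-(z / 2) * t)) hmem
    (Filter.Eventually.of_forall fun w =>
      (continuous_sincTailIntegrand w).aestronglyMeasurable)
    ((integrableOn_exp_mul_Ioi (neg_lt_zero.2 hz) 0).mono'
      (continuous_sincTailIntegrand z).aestronglyMeasurable
      (Filter.Eventually.of_forall fun t => abs_sincTailIntegrand_le_exp z t))
    (Continuous.aestronglyMeasurable (by fun_prop))
    ?_ (integrableOn_exp_mul_Ioi (by linarith) 0)
    (Filter.Eventually.of_forall fun t w _ => hasDerivAt_sincTailIntegrand w t)).2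
  · refine h.congr_deriv ?_
    rw [integral_neg, integral_mul_const, integral_exp_neg_mul_Ioi_zero hz,
      Real.sinc_of_ne_zero hz.ne']
    ring
  · filter_upwards [ae_restrict_mem measurableSet_Ioi] with t ht w hw
    rw [norm_neg, norm_mul, Real.norm_eq_abs, Real.abs_exp]
    refine (mul_le_of_le_one_right (Real.exp_pos _).le (Real.abs_sin_le_one w)).trans ?_
    have ht' : 0 < t := ht
    have hw' : z / 2 < w := hw
    exact Real.exp_le_exp.2 (by nlinarith)

theorem tendsto_sincTail_zero :
    Filter.Tendsto sincTail (𝓝[>] 0) (𝓝 (Real.pi / 2)) := by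
  have hlim : ∫ t in Set.Ioi (0 : ℝ), sincTailIntegrand 0 t = Real.pi / 2 := by
    simp [sincTailIntegrand, integral_Ioi_inv_one_add_sq]
  rw [← hlim]
  refine tendsto_integral_filter_of_dominated_convergence (fun t => 2 * (1 + t ^ 2)⁻¹)
    (Filter.Eventually.of_forall fun w =>
      (continuous_sincTailIntegrand w).aestronglyMeasurable) ?_
    (integrable_inv_one_add_sq.const_mul 2).integrableOn
    (Filter.Eventually.of_forall fun t =>
      (hasDerivAt_sincTailIntegrand 0 t).continuousAt.tendsto.mono_left nhdsWithin_le_nhds)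
  filter_upwards [self_mem_nhdsWithin] with w hw
  filter_upwards [ae_restrict_mem measurableSet_Ioi] with t ht
  exact abs_sincTailIntegrand_le_inv_one_add_sq (le_of_lt hw) (le_of_lt ht)

theorem hasDerivAt_integral_sinc (z : ℝ) :
    HasDerivAt (fun z => ∫ s in (0 : ℝ)..z, Real.sinc s) (Real.sinc z) z :=
  intervalIntegral.integral_hasDerivAt_right (Real.continuous_sinc.intervalIntegrable _ _)
    (Real.continuous_sinc.stronglyMeasurableAtFilter _ _) Real.continuous_sinc.continuousAt

theorem integral_sinc_add_sincTail {z : ℝ} (hz : 0 < z) :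
    (∫ s in (0 : ℝ)..z, Real.sinc s) + sincTail z = Real.pi / 2 := by
  set D : ℝ → ℝ := fun z => (∫ s in (0 : ℝ)..z, Real.sinc s) + sincTail z with hD
  have hderiv : ∀ w ∈ Set.Ioi (0 : ℝ), HasDerivAt D 0 w := fun w hw => by
    exact ((hasDerivAt_integral_sinc w).add (hasDerivAt_sincTail hw)).congr_deriv
      (add_neg_cancel _)
  have hconst : ∀ w ∈ Set.Ioi (0 : ℝ), D w = D z := fun w hw =>
    isOpen_Ioi.is_const_of_deriv_eq_zero isPreconnected_Ioi
      (fun x hx => (hderiv x hx).differentiableAt.differentiableWithinAt)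
      (fun x hx => (hderiv x hx).deriv) hw hz
  have hlim : Filter.Tendsto D (𝓝[>] 0) (𝓝 (Real.pi / 2)) := by
    have h0 := (hasDerivAt_integral_sinc 0).continuousAt.tendsto.mono_left
      (nhdsWithin_le_nhds (s := Set.Ioi 0))
    simpa using h0.add tendsto_sincTail_zero
  refine tendsto_nhds_unique (tendsto_const_nhds.congr' ?_) hlim
  filter_upwards [self_mem_nhdsWithin] with w hw
  exact (hconst w hw).symm

theorem sineKernel_two_mul_zero (t : ℝ) :
    sineKernel (2 * t) 0 = Real.sinc (2 * Real.pi * t) := by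
  by_cases ht : t = 0
  · simp [sineKernel, ht]
  · rw [sineKernel, if_neg (by simpa using ht), Real.sinc_of_ne_zero (by positivity), sub_zero,
      show Real.pi * (2 * t) = 2 * Real.pi * t by ring]

theorem I4_eq_integral_sinc (x y : ℝ) :
    I4 x y = (2 * Real.pi)⁻¹ * ∫ s in (0 : ℝ)..2 * Real.pi * (x - y), Real.sinc s := by
  simp_rw [I4, sineKernel_two_mul_zero]
  rw [intervalIntegral.integral_comp_mul_left _ (by positivity)]
  simp

theorem I4_swap (x y : ℝ) : I4 y x = -I4 x y := by
  have h : ∀ w : ℝ, ∫ s in (0 : ℝ)..-w, Real.sinc s = -∫ s in (0 : ℝ)..w, Real.sinc s := by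
    intro w
    have := intervalIntegral.integral_comp_neg (a := 0) (b := w) Real.sinc
    simp only [Real.sinc_neg, neg_zero] at this
    rw [this, intervalIntegral.integral_symm]
  rw [I4_eq_integral_sinc, I4_eq_integral_sinc,
    show 2 * Real.pi * (y - x) = -(2 * Real.pi * (x - y)) by ring, h, mul_neg]

theorem abs_I4_le_abs_sub (x y : ℝ) : |I4 x y| ≤ |x - y| := by
  have h := intervalIntegral.norm_integral_le_of_norm_le_const
    (a := 0) (b := x - y) (C := 1) (f := fun t => sineKernel (2 * t) 0) (fun t _ => by
      rw [sineKernel_two_mul_zero]; exact Real.abs_sinc_le_one _)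
  simpa [I4] using h

theorem abs_I4_sub_quarter_le {x y : ℝ} (h : y < x) : |I4 x y - 1 / 4| ≤ (x - y)⁻¹ := by
  have hd : 0 < x - y := sub_pos.2 h
  have hpi := Real.pi_pos
  have hz : 0 < 2 * Real.pi * (x - y) := by positivity
  have hI : I4 x y - 1 / 4 = -((2 * Real.pi)⁻¹ * sincTail (2 * Real.pi * (x - y))) := by
    rw [I4_eq_integral_sinc, eq_sub_of_add_eq (integral_sinc_add_sincTail hz)]
    field_simp
    ring
  have h1 : (2 * Real.pi)⁻¹ ≤ 1 := inv_le_one_of_one_le₀ (by linarith [Real.pi_gt_three])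
  have h2 : (2 * Real.pi * (x - y))⁻¹ ≤ (x - y)⁻¹ :=
    inv_anti₀ hd (by nlinarith [Real.pi_gt_three])
  rw [hI, abs_neg, abs_mul, abs_of_pos (by positivity)]
  calc (2 * Real.pi)⁻¹ * |sincTail (2 * Real.pi * (x - y))|
      ≤ 1 * |sincTail (2 * Real.pi * (x - y))| :=
        mul_le_mul_of_nonneg_right h1 (abs_nonneg _)
    _ ≤ (x - y)⁻¹ := by rw [one_mul]; exact (abs_sincTail_le hz).trans h2

theorem abs_I4_add_quarter_le {x y : ℝ} (h : x < y) : |I4 x y + 1 / 4| ≤ (y - x)⁻¹ := by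
  have := abs_I4_sub_quarter_le h
  rwa [I4_swap, ← abs_neg, neg_sub, sub_neg_eq_add, add_comm] at this

theorem abs_I4_sub_quarter_le_five_quarters {x y : ℝ} (h : y < x) :
    |I4 x y - 1 / 4| ≤ 5 / 4 := by
  rcases le_total (x - y) 1 with h1 | h1
  · have := abs_I4_le_abs_sub x y
    rw [abs_of_pos (sub_pos.2 h), abs_le] at this
    rw [abs_le]; constructor <;> linarith
  · exact (abs_I4_sub_quarter_le h).trans ((inv_le_one_of_one_le₀ h1).trans (by norm_num))

theorem abs_I4_le (x y : ℝ) : |I4 x y| ≤ 3 / 2 := by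
  rcases lt_trichotomy x y with h | rfl | h
  · have := abs_I4_sub_quarter_le_five_quarters h
    rw [I4_swap] at this
    rw [abs_le] at this ⊢; constructor <;> linarith
  · rw [I4, sub_self, intervalIntegral.integral_same, abs_zero]
    norm_num
  · have := abs_I4_sub_quarter_le_five_quarters h
    rw [abs_le] at this ⊢; constructor <;> linarith

theorem sq_le_of_abs_le_inv {a w : ℝ} (hw : 0 < w) (h1 : |a| ≤ w⁻¹) (h2 : |a| ≤ 2) :
    a ^ 2 ≤ 8 * (1 + w ^ 2)⁻¹ := by
  have haw : |a| * w ≤ 1 := by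
    calc |a| * w ≤ w⁻¹ * w := mul_le_mul_of_nonneg_right h1 hw.le
      _ = 1 := inv_mul_cancel₀ hw.ne'
  have e1 : (|a| * w) ^ 2 ≤ 1 := pow_le_one₀ (by positivity) haw
  have e2 : |a| ^ 2 ≤ 2 ^ 2 := pow_le_pow_left₀ (abs_nonneg a) h2 2
  rw [mul_pow, sq_abs] at e1
  rw [sq_abs] at e2
  rw [← div_eq_mul_inv, le_div_iff₀ (by positivity)]
  linarith

theorem abs_Rker_le_two (u v x y : ℝ) : |Rker u v x y| ≤ 2 := by
  have h := abs_le.1 (abs_I4_le (x + u) (y + v))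
  unfold Rker
  split_ifs <;> exact abs_le.2 ⟨by linarith, by linarith⟩

theorem Rker_sq_le_of_lt_abs_sub {u v x y : ℝ} (h : |u - v| < |x - y|) :
    Rker u v x y ^ 2 ≤ 8 * (1 + (x + (u - y - v)) ^ 2)⁻¹ := by
  have h2 := abs_Rker_le_two u v x y
  have huv := abs_le.1 (le_refl |u - v|)
  by_cases hxy : y < x
  · rw [abs_of_pos (sub_pos.2 hxy)] at h
    have hw : y + v < x + u := by linarith
    rw [show x + (u - y - v) = x + u - (y + v) by ring]
    refine sq_le_of_abs_le_inv (sub_pos.2 hw) ?_ h2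
    rw [Rker, if_pos hxy]
    exact abs_I4_sub_quarter_le hw
  · rw [abs_of_nonpos (sub_nonpos.2 (not_lt.1 hxy))] at h
    have hw : x + u < y + v := by linarith
    rw [show (x + (u - y - v)) ^ 2 = (y + v - (x + u)) ^ 2 by ring]
    refine sq_le_of_abs_le_inv (sub_pos.2 hw) ?_ h2
    rw [Rker, if_neg hxy]
    exact abs_I4_add_quarter_le hw

theorem Rker_sq_le {u v α : ℝ} (hu : |u| ≤ α) (hv : |v| ≤ α) (x y : ℝ) :
    ENNReal.ofReal (Rker u v x y ^ 2) ≤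
      (Set.Icc (y - 2 * α) (y + 2 * α)).indicator (fun _ => ENNReal.ofReal 4) x +
        ENNReal.ofReal (8 * (1 + (x + (u - y - v)) ^ 2)⁻¹) := by
  by_cases hx : x ∈ Set.Icc (y - 2 * α) (y + 2 * α)
  · rw [Set.indicator_of_mem hx]
    refine le_add_right (ENNReal.ofReal_le_ofReal ?_)
    have h := pow_le_pow_left₀ (abs_nonneg _) (abs_Rker_le_two u v x y) 2
    rw [sq_abs] at h
    linarith
  · refine le_add_left (ENNReal.ofReal_le_ofReal (Rker_sq_le_of_lt_abs_sub ?_))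
    by_contra! hle
    have h := abs_le.1 (hle.trans ((abs_sub u v).trans (add_le_add hu hv)))
    exact hx ⟨by linarith, by linarith⟩

theorem lintegral_inv_one_add_sq_translate (c : ℝ) :
    ∫⁻ x : ℝ, ENNReal.ofReal (8 * (1 + (x + c) ^ 2)⁻¹) = ENNReal.ofReal (8 * Real.pi) := by
  rw [lintegral_add_right_eq_self (fun x : ℝ => ENNReal.ofReal (8 * (1 + x ^ 2)⁻¹)) c,
    ← ofReal_integral_eq_lintegral_ofReal (integrable_inv_one_add_sq.const_mul 8)
      (Filter.Eventually.of_forall fun x => by positivity),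
    integral_const_mul, integral_univ_inv_one_add_sq]

/-- There is `C > 0` such that for every `α > 0`, all `u,v ∈ [−α,α]` and
every `y ∈ ℝ`: `∫_ℝ ℛ_{u,v}(x,y)² dx ≤ C·max(1,α)`. -/
theorem Rker_sq_integral_le :
    ∃ C > 0, ∀ α : ℝ, 0 < α → ∀ u v : ℝ, |u| ≤ α → |v| ≤ α → ∀ y : ℝ,
      ∫⁻ x : ℝ, ENNReal.ofReal (Rker u v x y ^ 2)
        ≤ ENNReal.ofReal (C * max 1 α) := by
  refine ⟨48, by norm_num, fun α hα u v hu hv y => ?_⟩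
  refine (lintegral_mono fun x => Rker_sq_le hu hv x y).trans ?_
  rw [lintegral_add_left (measurable_const.indicator measurableSet_Icc),
    lintegral_indicator_const measurableSet_Icc, lintegral_inv_one_add_sq_translate,
    Real.volume_Icc, ← ENNReal.ofReal_mul (by norm_num),
    ← ENNReal.ofReal_add (by nlinarith) (by positivity)]
  refine ENNReal.ofReal_le_ofReal ?_
  linarith [le_max_left 1 α, le_max_right 1 α, Real.pi_lt_four]
end

section
/- Define the 2×2 matrix kernels K₁ and K₄ as follows: K₁(x,y) has entries (K₁)₁₁(x,y) = (K₁)₂₂(y,x) = K₂(x,y), (K₁)₁₂(x,y) = D₁(x,y) := ∂ₓK₂(x,y), (K₁)₂₁(x,y) = I₁(x,y) := ∫₀^{x−y} K₂(t,0) dt − ½ sgn(x−y); and K₄(x,y) has entries (K₄)₁₁(x,y) = (K₄)₂₂(y,x) = S₄(x,y) := K₂(2x,2y), (K₄)₁₂(x,y) = D₄(x,y) := ∂ₓK₂(2x,2y), (K₄)₂₁(x,y) = I₄(x,y) := ∫₀^{x−y} K₂(2t,0) dt. For a subset S = {i₁ < … < i_r} ⊆ {1,…,2k}, a bijection σ :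 S → S, a vector d ∈ {1,2}^{2k} and t ∈ ℝ^{2k}, set F_{S,σ}^{K}(d, t) := (1/(2r)) · (K(t_{σ(i₁)}, t_{σ(i₂)}))_{d_{i₁} d_{i₂}} (K(t_{σ(i₂)}, t_{σ(i₃)}))_{d_{i₂} d_{i₃}} ⋯ (K(t_{σ(i_r)}, t_{σ(i₁)}))_{d_{i_r} d_{i₁}}. For an interval A ⊂ ℝ and α > 0 let χ_α(t₁,…,t_k) be the indicator that max_i t_i − min_i t_i < α and t_i ∈ A for all i. Then for each β ∈ {1,4} there exists a constant C > 0 such that for all positive integers k and N, all m ∈ {1,…,2k}, every partition S₁,…,S_m of {1,…,2k} into nonempty blocks having at least one block S_{i₀} with S_{i₀} ∩ {1,…,k} ≠ ∅ and S_{i₀} ∩ {k+1,…,2k} ≠ ∅, all bijections σ₁ ∈ 𝔖(S₁),…,σ_m ∈ 𝔖(S_m), every bounded interval A ⊂ ℝ with |A| ≥ 1 and every α > 0: | Σ_{d₁,…,d_{2k} = 1}^{2} ∫_{A^{2k}} ( Π_{i=1}^{m} F_{S_i,σ_i}^{K_β}(d, t) ) · χ_α(t₁,…,t_k) · χ_α(t_{k+1},…,t_{2k})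 dt₁ ⋯ dt_{2k} | ≤ C^k · max(1,α)^{2k−1} · |A|, where the constant C is uniform in α, k, m, A, the partition and the bijections. -/
open MeasureTheory

/-- `D₁(x,y) = ∂ₓK₂(x,y)`. -/
noncomputable def D1 (x y : ℝ) : ℝ :=
  if x = y then 0
  else (Real.pi * (x - y) * Real.cos (Real.pi * (x - y)) - Real.sin (Real.pi * (x - y)))
        / (Real.pi * (x - y) ^ 2)

/-- `I₁(x,y) = ∫_0^{x−y} K₂(t,0) dt − ½ sgn(x−y)`. -/
noncomputable def I1 (x y : ℝ) : ℝ :=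
  (∫ t in (0 : ℝ)..(x - y), sineKernel t 0) - (1 / 2) * Real.sign (x - y)

/-- `S₄(x,y) = K₂(2x,2y)`. -/
noncomputable def S4 (x y : ℝ) : ℝ := sineKernel (2 * x) (2 * y)

/-- `D₄(x,y) = ∂ₓK₂(2x,2y)`. -/
noncomputable def D4 (x y : ℝ) : ℝ :=
  if x = y then 0
  else (2 * Real.pi * (x - y) * Real.cos (2 * Real.pi * (x - y))
          - Real.sin (2 * Real.pi * (x - y)))
        / (2 * Real.pi * (x - y) ^ 2)

/-- The limiting 2×2 matrix kernel `K₁` for orthogonal (β = 1) invariant ensembles: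
`(K₁)₁₁(x,y) = (K₁)₂₂(y,x) = K₂(x,y)`, `(K₁)₁₂ = D₁`, `(K₁)₂₁ = I₁`.
(Row/column index `0 : Fin 2` encodes the kernel index `1`, `1 : Fin 2` encodes `2`.) -/
noncomputable def K1mat (x y : ℝ) : Matrix (Fin 2) (Fin 2) ℝ :=
  !![sineKernel x y, D1 x y; I1 x y, sineKernel y x]

/-- The limiting 2×2 matrix kernel `K₄` for symplectic (β = 4) invariant ensembles:
`(K₄)₁₁(x,y) = (K₄)₂₂(y,x) = S₄(x,y)`, `(K₄)₁₂ = D₄`, `(K₄)₂₁ = I₄`. -/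
noncomputable def K4mat (x y : ℝ) : Matrix (Fin 2) (Fin 2) ℝ :=
  !![S4 x y, D4 x y; I4 x y, S4 y x]

/-- The cyclic product
`F_{S,σ}^K(d,t) = (1/(2r)) ∏_{j=1}^{r} (K(t_{σ(i_j)}, t_{σ(i_{j+1 mod r})}))_{d_{i_j}, d_{i_{j+1 mod r}}}`
for a block `S = {i₁ < … < i_r} ⊆ {1,…,n}` and a bijection `σ` of `S`; the `j`-th
element `i_j` of `S` is `S.orderIsoOfFin rfl j`, and the cyclic successor `j ↦ j+1
(mod r)` is `finRotate`. -/
noncomputable def Fcyc (n : ℕ) (K : ℝ → ℝ → Matrix (Fin 2) (Fin 2) ℝ)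
    (S : Finset (Fin n)) (σ : Equiv.Perm {x // x ∈ S})
    (d : Fin n → Fin 2) (t : Fin n → ℝ) : ℝ :=
  (1 / (2 * (S.card : ℝ))) *
    ∏ j : Fin S.card,
      K (t (σ (S.orderIsoOfFin rfl j)).val)
        (t (σ (S.orderIsoOfFin rfl (finRotate S.card j))).val)
        (d ((S.orderIsoOfFin rfl j) : {x // x ∈ S}).val)
        (d ((S.orderIsoOfFin rfl (finRotate S.card j)) : {x // x ∈ S}).val)

open Classical in
/-- The localized indicator `χ_α(u₁,…,u_k)`: equal to `1` if all `u_i ∈ A` and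
`max_i u_i − min_i u_i < α`, and `0` otherwise. -/
noncomputable def chiInd (A : Set ℝ) (α : ℝ) {ι : Type*} (u : ι → ℝ) : ℝ :=
  if (∀ i, u i ∈ A) ∧ (∀ i j, u i - u j < α) then 1 else 0

theorem integral_sinc_sub_arctan_le {T X : ℝ} (hT : 0 < T) (hX : 0 < X) :
    |(∫ t in (0 : ℝ)..T, Real.sinc t) - Real.arctan X| ≤ 2 / T + 1 / X := by
  have inner_u : ∀ t : ℝ, ∫ u in (0 : ℝ)..X, Real.sin t * Real.exp (-(u * t)) =
      Real.sinc t * (1 - Real.exp (-(X * t))) := by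
    intro t
    rcases eq_or_ne t 0 with rfl | ht
    · simp
    have h : ∀ u ∈ Set.uIcc 0 X, HasDerivAt (fun u => -(Real.sin t / t) * Real.exp (-(u * t)))
        (Real.sin t * Real.exp (-(u * t))) u := by
      intro u _
      have := ((((hasDerivAt_id u).mul_const t).neg).exp).const_mul (-(Real.sin t / t))
      refine this.congr_deriv ?_
      simp only [id, Pi.neg_apply]
      field_simp
    rw [intervalIntegral.integral_eq_sub_of_hasDerivAt h
      (Continuous.intervalIntegrable (by fun_prop) _ _), Real.sinc_of_ne_zero ht]
    simp
    ring
  have inner_t : ∀ u : ℝ, ∫ t in (0 : ℝ)..T, Real.sin t * Real.exp (-(u * t)) =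
      (1 + u ^ 2)⁻¹ - Real.exp (-(u * T)) * (u * Real.sin T + Real.cos T) * (1 + u ^ 2)⁻¹ := by
    intro u
    have hu : (1 + u ^ 2) ≠ 0 := by positivity
    have h : ∀ t ∈ Set.uIcc 0 T, HasDerivAt
        (fun t => -(Real.exp (-(u * t)) * (u * Real.sin t + Real.cos t) * (1 + u ^ 2)⁻¹))
        (Real.sin t * Real.exp (-(u * t))) t := by
      intro t _
      have h1 := (((hasDerivAt_id t).const_mul u).neg).exp
      have h2 := ((Real.hasDerivAt_sin t).const_mul u).add (Real.hasDerivAt_cos t)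
      refine (((h1.mul h2).mul_const (1 + u ^ 2)⁻¹).neg).congr_deriv ?_
      simp only [id, Pi.neg_apply, Pi.add_apply]
      field_simp
      ring
    rw [intervalIntegral.integral_eq_sub_of_hasDerivAt h
      (Continuous.intervalIntegrable (by fun_prop) _ _)]
    simp
    ring
  have swap : ∫ t in (0 : ℝ)..T, ∫ u in (0 : ℝ)..X, Real.sin t * Real.exp (-(u * t)) =
      ∫ u in (0 : ℝ)..X, ∫ t in (0 : ℝ)..T, Real.sin t * Real.exp (-(u * t)) := by
    simp only [intervalIntegral.integral_of_le hT.le, intervalIntegral.integral_of_le hX.le]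
    refine MeasureTheory.integral_integral_swap ?_
    rw [Measure.prod_restrict]
    refine IntegrableOn.mono_set (t := Set.Icc 0 T ×ˢ Set.Icc 0 X) ?_
      (Set.prod_mono Set.Ioc_subset_Icc_self Set.Ioc_subset_Icc_self)
    refine ContinuousOn.integrableOn_compact (isCompact_Icc.prod isCompact_Icc) ?_
    simp only [Function.uncurry_def]
    fun_prop
  simp only [inner_u, inner_t] at swap
  have c2 : Continuous fun u : ℝ => (1 + u ^ 2)⁻¹ :=
    Continuous.inv₀ (by fun_prop) (fun u => by positivity)
  have cs := Real.continuous_sinc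
  have e1 : ∫ t in (0 : ℝ)..T, Real.sinc t * (1 - Real.exp (-(X * t))) =
      (∫ t in (0 : ℝ)..T, Real.sinc t) - ∫ t in (0 : ℝ)..T, Real.sinc t * Real.exp (-(X * t)) := by
    rw [← intervalIntegral.integral_sub (cs.intervalIntegrable _ _)
      (Continuous.intervalIntegrable (by fun_prop) _ _)]
    congr 1 with t
    ring
  rw [e1, intervalIntegral.integral_sub (c2.intervalIntegrable _ _)
      (Continuous.intervalIntegrable (by fun_prop) _ _), integral_inv_one_add_sq,
      Real.arctan_zero] at swap
  have expInt : ∀ {c Y : ℝ}, 0 < c → ∫ t in (0 : ℝ)..Y, Real.exp (-(c * t)) ≤ 1 / c := by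
    intro c Y hc
    have h : ∀ u ∈ Set.uIcc 0 Y, HasDerivAt (fun u => -(1 / c) * Real.exp (-(c * u)))
        (Real.exp (-(c * u))) u := by
      intro u _
      have := ((((hasDerivAt_id u).const_mul c).neg).exp).const_mul (-(1 / c))
      refine this.congr_deriv ?_
      simp only [id, Pi.neg_apply]
      field_simp
    rw [intervalIntegral.integral_eq_sub_of_hasDerivAt h
      (Continuous.intervalIntegrable (by fun_prop) _ _)]
    have : 0 ≤ 1 / c * Real.exp (-(c * Y)) := by positivity
    simp at this ⊢
    linarith
  have b1 : |∫ t in (0 : ℝ)..T, Real.sinc t * Real.exp (-(X * t))| ≤ 1 / X := by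
    refine le_trans ?_ (expInt hX (Y := T))
    rw [← Real.norm_eq_abs]
    refine intervalIntegral.norm_integral_le_of_norm_le (μ := volume)
      (g := fun t => Real.exp (-(X * t))) hT.le (ae_of_all volume fun t _ => ?_)
      (Continuous.intervalIntegrable (by fun_prop) _ _)
    rw [norm_mul, Real.norm_eq_abs, Real.norm_eq_abs, Real.abs_exp]
    exact mul_le_of_le_one_left (Real.exp_pos _).le (Real.abs_sinc_le_one t)
  have b2 : |∫ u in (0 : ℝ)..X, Real.exp (-(u * T)) * (u * Real.sin T + Real.cos T)
      * (1 + u ^ 2)⁻¹| ≤ 2 / T := by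
    have : ∫ u in (0 : ℝ)..X, 2 * Real.exp (-(T * u)) ≤ 2 / T := by
      rw [intervalIntegral.integral_const_mul]
      have := expInt hT (Y := X)
      rw [show 2 / T = 2 * (1 / T) by ring]
      linarith
    refine le_trans ?_ this
    rw [← Real.norm_eq_abs]
    refine intervalIntegral.norm_integral_le_of_norm_le (μ := volume)
     
      (g := fun u => 2 * Real.exp (-(T * u))) hX.le (ae_of_all volume fun u hu => ?_)
      (Continuous.intervalIntegrable (by fun_prop) _ _)
    rw [norm_mul, norm_mul, Real.norm_eq_abs, Real.abs_exp, mul_comm u T, mul_assoc, mul_comm 2]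
    refine mul_le_mul_of_nonneg_left ?_ (Real.exp_pos _).le
    have hpos : 0 < 1 + u ^ 2 := by positivity
    rw [norm_inv, Real.norm_eq_abs, Real.norm_eq_abs, abs_of_pos hpos, ← div_eq_mul_inv,
      div_le_iff₀ hpos]
    have h1 : |u * Real.sin T + Real.cos T| ≤ |u| + 1 := by
      refine (abs_add_le _ _).trans (add_le_add ?_ (Real.abs_cos_le_one T))
      rw [abs_mul]
      exact mul_le_of_le_one_right (abs_nonneg _) (Real.abs_sin_le_one T)
    nlinarith [sq_nonneg (|u| - 1), sq_abs u]
  have : (∫ t in (0 : ℝ)..T, Real.sinc t) - Real.arctan X =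
      (∫ t in (0 : ℝ)..T, Real.sinc t * Real.exp (-(X * t))) -
      ∫ u in (0 : ℝ)..X, Real.exp (-(u * T)) * (u * Real.sin T + Real.cos T)
      * (1 + u ^ 2)⁻¹ := by linarith
  rw [this]
  refine (abs_sub _ _).trans ?_
  linarith

/-- Quantitative Dirichlet integral. -/
theorem abs_integral_sinc_sub_pi_div_two_le {T : ℝ} (hT : 0 < T) :
    |(∫ t in (0 : ℝ)..T, Real.sinc t) - Real.pi / 2| ≤ 2 / T := by
  have h1 : Filter.Tendsto (fun X => |(∫ t in (0 : ℝ)..T, Real.sinc t) - Real.arctan X|)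
      Filter.atTop (nhds |(∫ t in (0 : ℝ)..T, Real.sinc t) - Real.pi / 2|) :=
    ((tendsto_nhds_of_tendsto_nhdsWithin Real.tendsto_arctan_atTop).const_sub _).abs
  have h2 : Filter.Tendsto (fun X : ℝ => 2 / T + 1 / X) Filter.atTop (nhds (2 / T + 0)) := by
    refine tendsto_const_nhds.add ?_
    exact tendsto_const_nhds.div_atTop Filter.tendsto_id
  rw [add_zero] at h2
  refine le_of_tendsto_of_tendsto h1 h2 ?_
  filter_upwards [Filter.eventually_gt_atTop 0] with X hX
  exact integral_sinc_sub_arctan_le hT hX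

/-- A bounded square-integrable function whose integrals over intervals are uniformly bounded. -/
structure Tame (f : ℝ → ℝ) (M : ℝ) : Prop where
  meas : Measurable f
  bdd : ∀ u, |f u| ≤ M
  sq_int : Integrable fun u => f u ^ 2
  sq_le : ∫ u, f u ^ 2 ≤ M
  osc : ∀ x y, |∫ u in x..y, f u| ≤ M

theorem Tame.mono {f : ℝ → ℝ} {M M' : ℝ} (h : Tame f M) (hM : M ≤ M') : Tame f M' :=
  ⟨h.meas, fun u => (h.bdd u).trans hM, h.sq_int, h.sq_le.trans hM,
    fun x y => (h.osc x y).trans hM⟩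

theorem exists_tame_of_decay {f : ℝ → ℝ} {c : ℝ} (hf : Measurable f) (hb : ∀ u, |f u| ≤ c)
    (hd : ∀ u, |u * f u| ≤ c) (ho : ∀ x y, |∫ u in x..y, f u| ≤ c) : ∃ M, Tame f M := by
  have hint : Integrable fun u => f u ^ 2 := by
    refine (integrable_inv_one_add_sq.const_mul (2 * c ^ 2)).mono'
      (hf.pow_const 2).aestronglyMeasurable (ae_of_all _ fun u => ?_)
    have hpos : 0 < 1 + u ^ 2 := by positivity
    rw [Real.norm_eq_abs, abs_of_nonneg (sq_nonneg _), ← div_eq_mul_inv, le_div_iff₀ hpos]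
    have h1 := sq_le_sq' (by linarith [neg_abs_le (f u), hb u]) ((le_abs_self _).trans (hb u))
    have h2 := sq_le_sq' (by linarith [neg_abs_le (u * f u), hd u]) ((le_abs_self _).trans (hd u))
    nlinarith
  have h0 : 0 ≤ ∫ u, f u ^ 2 := integral_nonneg fun u => sq_nonneg _
  have hc : 0 ≤ c := (abs_nonneg _).trans (hb 0)
  exact ⟨c + ∫ u, f u ^ 2, hf, fun u => (hb u).trans (by linarith), hint, by linarith,
    fun x y => (ho x y).trans (by linarith)⟩

theorem Tame.comp_two_mul {f : ℝ → ℝ} {M : ℝ} (h : Tame f M) (c : ℝ) :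
    ∃ M', Tame (fun u => c * f (2 * u)) M' := by
  have hM : 0 ≤ M := (abs_nonneg _).trans (h.bdd 0)
  refine ⟨|c| * M + c ^ 2 * M, (h.meas.comp (measurable_const_mul 2)).const_mul c, fun u => ?_,
    ?_, ?_, fun x y => ?_⟩
  · rw [abs_mul]
    have := mul_le_mul_of_nonneg_left (h.bdd (2 * u)) (abs_nonneg c)
    nlinarith [mul_nonneg (sq_nonneg c) hM]
  · simp_rw [mul_pow]
    exact (h.sq_int.comp_mul_left' two_ne_zero).const_mul _
  · simp_rw [mul_pow]
    rw [integral_const_mul, Measure.integral_comp_mul_left (fun u => f u ^ 2)]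
    have h0 : 0 ≤ ∫ u, f u ^ 2 := integral_nonneg fun u => sq_nonneg _
    have h2 : |(2 : ℝ)⁻¹| • ∫ u, f u ^ 2 ≤ M := by
      rw [abs_of_pos (by norm_num), smul_eq_mul]
      linarith [h.sq_le]
    nlinarith [mul_le_mul_of_nonneg_left h2 (sq_nonneg c), mul_nonneg (abs_nonneg c) hM]
  · rw [intervalIntegral.integral_const_mul, abs_mul,
      intervalIntegral.integral_comp_mul_left f two_ne_zero, smul_eq_mul, abs_mul,
      abs_of_pos (by norm_num : (0 : ℝ) < 2⁻¹)]
    have h1 := mul_le_mul_of_nonneg_left (h.osc (2 * x) (2 * y)) (abs_nonneg c)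
    nlinarith [mul_nonneg (sq_nonneg c) hM, mul_nonneg (abs_nonneg c) hM,
      mul_nonneg (abs_nonneg c) (abs_nonneg (∫ u in 2 * x..2 * y, f u))]

noncomputable def sincPi (u : ℝ) : ℝ := Real.sinc (Real.pi * u)

noncomputable def sincPiDeriv (u : ℝ) : ℝ :=
  if u = 0 then 0
  else (Real.pi * u * Real.cos (Real.pi * u) - Real.sin (Real.pi * u)) / (Real.pi * u ^ 2)

noncomputable def sincPiTail (u : ℝ) : ℝ :=
  (∫ t in (0 : ℝ)..u, sincPi t) - (1 / 2) * Real.sign u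

theorem continuous_sincPi : Continuous sincPi :=
  Real.continuous_sinc.comp (continuous_const_mul _)

theorem sincPi_neg (u : ℝ) : sincPi (-u) = sincPi u := by
  simp [sincPi, Real.sinc_neg]

theorem abs_sincPi_le (u : ℝ) : |sincPi u| ≤ 1 := Real.abs_sinc_le_one _

theorem mul_sincPi (u : ℝ) : u * sincPi u = Real.sin (Real.pi * u) / Real.pi := by
  rcases eq_or_ne u 0 with rfl | hu
  · simp
  · rw [sincPi, Real.sinc_of_ne_zero (by positivity)]
    field_simp

theorem abs_mul_sincPi_le (u : ℝ) : |u * sincPi u| ≤ 1 := by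
  rw [mul_sincPi, abs_div, abs_of_pos Real.pi_pos, div_le_one Real.pi_pos]
  linarith [Real.abs_sin_le_one (Real.pi * u), Real.pi_gt_three]

theorem integral_sincPi_neg (u : ℝ) :
    ∫ t in (0 : ℝ)..(-u), sincPi t = -∫ t in (0 : ℝ)..u, sincPi t := by
  have := intervalIntegral.integral_comp_neg (a := 0) (b := u) sincPi
  rw [neg_zero] at this
  rw [intervalIntegral.integral_symm, ← this]
  simp [sincPi_neg]

theorem sincPiTail_neg (u : ℝ) : sincPiTail (-u) = -sincPiTail u := by
  rw [sincPiTail, integral_sincPi_neg, sincPiTail, Real.sign_neg]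
  ring

theorem measurable_integral_sincPi : Measurable fun u : ℝ => ∫ t in (0 : ℝ)..u, sincPi t :=
  (intervalIntegral.continuous_primitive (fun _ _ => continuous_sincPi.intervalIntegrable _ _)
    0).measurable

theorem measurable_sign_real : Measurable Real.sign := by
  have : Real.sign = fun r : ℝ => if r < 0 then (-1 : ℝ) else if 0 < r then 1 else 0 := rfl
  rw [this]
  exact Measurable.ite measurableSet_Iio measurable_const
    (Measurable.ite measurableSet_Ioi measurable_const measurable_const)

theorem abs_sign_le_one (u : ℝ) : |Real.sign u| ≤ 1 := by
  rcases Real.sign_apply_eq u with h | h | h <;> simp [h]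

theorem measurable_sincPiTail : Measurable sincPiTail :=
  measurable_integral_sincPi.sub (measurable_sign_real.const_mul _)

theorem measurable_sincPiDeriv : Measurable sincPiDeriv := by
  refine Measurable.ite (measurableSet_singleton 0) measurable_const ?_
  fun_prop

theorem abs_mul_sincPiTail_le (u : ℝ) : |u * sincPiTail u| ≤ 1 := by
  wlog hu : 0 ≤ u generalizing u
  · have := this (-u) (by linarith)
    rwa [sincPiTail_neg, neg_mul_neg] at this
  rcases hu.eq_or_lt with rfl | hu
  · simp
  have hpi := Real.pi_pos
  have h := abs_integral_sinc_sub_pi_div_two_le (T := Real.pi * u) (by positivity)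
  have e : u * sincPiTail u =
      u / Real.pi * ((∫ t in (0 : ℝ)..(Real.pi * u), Real.sinc t) - Real.pi / 2) := by
    have : ∫ t in (0 : ℝ)..u, sincPi t =
        Real.pi⁻¹ * ∫ t in (0 : ℝ)..(Real.pi * u), Real.sinc t := by
      have := intervalIntegral.integral_comp_mul_left (a := 0) (b := u) Real.sinc hpi.ne'
      rw [mul_zero, smul_eq_mul] at this
      exact this
    rw [sincPiTail, this, Real.sign_of_pos hu]
    field_simp
  rw [e, abs_mul, abs_of_pos (by positivity : 0 < u / Real.pi)]
  calc u / Real.pi * |(∫ t in (0 : ℝ)..(Real.pi * u), Real.sinc t) - Real.pi / 2|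
      ≤ u / Real.pi * (2 / (Real.pi * u)) := by gcongr
    _ = 2 / Real.pi ^ 2 := by field_simp
    _ ≤ 1 := by
      rw [div_le_one (by positivity)]
      nlinarith [Real.pi_gt_three]

theorem abs_sincPiTail_le (u : ℝ) : |sincPiTail u| ≤ 2 := by
  rcases le_total 1 |u| with h | h
  · have := abs_mul_sincPiTail_le u
    rw [abs_mul] at this
    nlinarith [abs_nonneg (sincPiTail u)]
  · have h1 : |∫ t in (0 : ℝ)..u, sincPi t| ≤ 1 * |u - 0| := by
      rw [← Real.norm_eq_abs]
      exact intervalIntegral.norm_integral_le_of_norm_le_const fun t _ => abs_sincPi_le t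
    have h2 := abs_sign_le_one u
    rw [sub_zero] at h1
    refine (abs_sub _ _).trans ?_
    rw [abs_mul, abs_of_pos (by norm_num : (0 : ℝ) < 1 / 2)]
    linarith

theorem abs_mul_sincPiDeriv_le (u : ℝ) : |u * sincPiDeriv u| ≤ 2 := by
  rcases eq_or_ne u 0 with rfl | hu
  · simp
  have : u * sincPiDeriv u = Real.cos (Real.pi * u) - sincPi u := by
    rw [sincPiDeriv, if_neg hu, sincPi, Real.sinc_of_ne_zero (by positivity)]
    field_simp
  rw [this]
  refine (abs_sub _ _).trans ?_
  linarith [Real.abs_cos_le_one (Real.pi * u), abs_sincPi_le u]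

theorem abs_mul_cos_sub_sin_le (v : ℝ) : |v * Real.cos v - Real.sin v| ≤ v ^ 2 := by
  have h := (convex_uIcc 0 v).norm_image_sub_le_of_norm_hasDerivWithin_le
    (f := fun v => v * Real.cos v - Real.sin v) (f' := fun v => -(v * Real.sin v)) (C := |v|)
    (fun x _ => (((hasDerivAt_id x).mul (Real.hasDerivAt_cos x)).sub
      (Real.hasDerivAt_sin x)).hasDerivWithinAt.congr_deriv (by simp)) (fun x hx => by
      have : |x| ≤ |v| := by simpa using Set.abs_sub_left_of_mem_uIcc hx
      rw [norm_neg, Real.norm_eq_abs, abs_mul]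
      nlinarith [Real.abs_sin_le_one x, abs_nonneg x, abs_nonneg (Real.sin x)])
    Set.left_mem_uIcc Set.right_mem_uIcc
  simpa [← sq] using h

theorem abs_sincPiDeriv_le (u : ℝ) : |sincPiDeriv u| ≤ Real.pi := by
  rcases eq_or_ne u 0 with rfl | hu
  · simp [sincPiDeriv, Real.pi_pos.le]
  have hpi := Real.pi_pos
  rw [sincPiDeriv, if_neg hu, abs_div, abs_of_pos (by positivity : 0 < Real.pi * u ^ 2),
    div_le_iff₀ (by positivity)]
  refine (abs_mul_cos_sub_sin_le _).trans (le_of_eq (by ring))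

theorem hasDerivAt_sincPi {u : ℝ} (hu : u ≠ 0) : HasDerivAt sincPi (sincPiDeriv u) u := by
  have hpi := Real.pi_ne_zero
  have h1 : HasDerivAt (fun u => Real.sin (Real.pi * u) / (Real.pi * u)) (sincPiDeriv u) u := by
    have h2 := (hasDerivAt_id u).const_mul Real.pi
    refine (h2.sin.div h2 (by simp [hu, hpi])).congr_deriv ?_
    rw [sincPiDeriv, if_neg hu]
    simp only [id]
    field_simp
  refine h1.congr_of_eventuallyEq ?_
  filter_upwards [isOpen_ne.mem_nhds hu] with y hy
  exact Real.sinc_of_ne_zero (mul_ne_zero hpi hy)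

theorem intervalIntegrable_of_abs_le {f : ℝ → ℝ} {c : ℝ} (hf : Measurable f)
    (hb : ∀ u, |f u| ≤ c) (x y : ℝ) : IntervalIntegrable f volume x y :=
  (intervalIntegrable_const (c := c)).mono_fun hf.aestronglyMeasurable
    (ae_of_all _ fun u => (hb u).trans (le_abs_self c))

theorem exists_tame_sincPiDeriv : ∃ M, Tame sincPiDeriv M := by
  refine exists_tame_of_decay (c := 4) measurable_sincPiDeriv
    (fun u => (abs_sincPiDeriv_le u).trans Real.pi_le_four)
    (fun u => (abs_mul_sincPiDeriv_le u).trans (by norm_num)) fun x y => ?_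
  rw [integral_eq_of_hasDerivAt_off_countable sincPi sincPiDeriv (Set.countable_singleton 0)
    continuous_sincPi.continuousOn (fun u hu => hasDerivAt_sincPi hu.2)
    (intervalIntegrable_of_abs_le measurable_sincPiDeriv abs_sincPiDeriv_le x y)]
  refine (abs_sub _ _).trans ?_
  linarith [abs_sincPi_le x, abs_sincPi_le y]

theorem exists_tame_sincPi : ∃ M, Tame sincPi M := by
  refine exists_tame_of_decay (c := 5) continuous_sincPi.measurable
    (fun u => (abs_sincPi_le u).trans (by norm_num))
    (fun u => (abs_mul_sincPi_le u).trans (by norm_num)) fun x y => ?_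
  have key : ∀ z : ℝ, |∫ t in (0 : ℝ)..z, sincPi t| ≤ 5 / 2 := fun z => by
    have h1 := abs_sincPiTail_le z
    have h2 := abs_sign_le_one z
    rw [sincPiTail] at h1
    rw [abs_le] at h1 h2 ⊢
    constructor <;> linarith
  rw [← intervalIntegral.integral_interval_sub_left (continuous_sincPi.intervalIntegrable 0 y)
    (continuous_sincPi.intervalIntegrable 0 x)]
  refine (abs_sub _ _).trans ?_
  linarith [key x, key y]

theorem hasDerivAt_mul_sincPiTail_add_cos {u : ℝ} (hu : u ≠ 0) :
    HasDerivAt (fun u => u * sincPiTail u + Real.cos (Real.pi * u) / Real.pi ^ 2)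
      (sincPiTail u) u := by
  have hpi := Real.pi_ne_zero
  have hs : HasDerivAt Real.sign 0 u := by
    refine (hasDerivAt_const u (Real.sign u)).congr_of_eventuallyEq ?_
    rcases lt_or_gt_of_ne hu with h | h
    · filter_upwards [isOpen_Iio.mem_nhds h] with y hy
      rw [Real.sign_of_neg h, Real.sign_of_neg hy]
    · filter_upwards [isOpen_Ioi.mem_nhds h] with y hy
      rw [Real.sign_of_pos h, Real.sign_of_pos hy]
  have h1 : HasDerivAt (fun u : ℝ => ∫ t in (0 : ℝ)..u, sincPi t) (sincPi u) u :=
    intervalIntegral.integral_hasDerivAt_right (continuous_sincPi.intervalIntegrable _ _)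
      (continuous_sincPi.stronglyMeasurableAtFilter _ _) continuous_sincPi.continuousAt
  have h2 : HasDerivAt sincPiTail (sincPi u) u :=
    (h1.sub (hs.const_mul (1 / 2))).congr_deriv (by ring)
  have h3 := (((hasDerivAt_id u).const_mul Real.pi).cos).div_const (Real.pi ^ 2)
  refine (((hasDerivAt_id u).mul h2).add h3).congr_deriv ?_
  simp only [id, mul_sincPi]
  field_simp
  ring

theorem continuous_mul_sincPiTail : Continuous fun u => u * sincPiTail u := by
  have : (fun u => u * sincPiTail u) =
      fun u => u * (∫ t in (0 : ℝ)..u, sincPi t) - (1 / 2) * |u| := by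
    ext u
    rw [sincPiTail]
    rcases lt_trichotomy u 0 with h | rfl | h
    · rw [Real.sign_of_neg h, abs_of_neg h]; ring
    · simp
    · rw [Real.sign_of_pos h, abs_of_pos h]; ring
  rw [this]
  have := intervalIntegral.continuous_primitive
    (fun _ _ => continuous_sincPi.intervalIntegrable (μ := volume) _ _) 0
  fun_prop

theorem exists_tame_sincPiTail : ∃ M, Tame sincPiTail M := by
  refine exists_tame_of_decay (c := 4) measurable_sincPiTail
    (fun u => (abs_sincPiTail_le u).trans (by norm_num))
    (fun u => (abs_mul_sincPiTail_le u).trans (by norm_num)) fun x y => ?_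
  have hpi := Real.pi_ne_zero
  have hcont : Continuous fun u => u * sincPiTail u + Real.cos (Real.pi * u) / Real.pi ^ 2 :=
    continuous_mul_sincPiTail.add (by fun_prop)
  rw [integral_eq_of_hasDerivAt_off_countable _ sincPiTail (Set.countable_singleton 0)
    hcont.continuousOn (fun u hu => hasDerivAt_mul_sincPiTail_add_cos hu.2)
    (intervalIntegrable_of_abs_le measurable_sincPiTail abs_sincPiTail_le x y)]
  have key : ∀ z : ℝ, |z * sincPiTail z + Real.cos (Real.pi * z) / Real.pi ^ 2| ≤ 2 := by
    intro z
    refine (abs_add_le _ _).trans ?_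
    have : |Real.cos (Real.pi * z) / Real.pi ^ 2| ≤ 1 := by
      rw [abs_div, abs_of_pos (by positivity : 0 < Real.pi ^ 2), div_le_one (by positivity)]
      nlinarith [Real.abs_cos_le_one (Real.pi * z), Real.pi_gt_three]
    linarith [abs_mul_sincPiTail_le z]
  refine (abs_sub _ _).trans ?_
  linarith [key x, key y]

/-- The matrix unit with entry `1` in row `1`, column `0`. -/
def lowerUnit (a b : Fin 2) : ℝ := if a = 1 ∧ b = 0 then 1 else 0

/-- The signs `+1`, `-1` of the two matrix indices. -/
def indexSign (a : Fin 2) : ℝ := if a = 0 then 1 else -1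

/-- A self-dual difference kernel `K` that splits as a tame kernel `K'` plus a multiple of
`sign` in the lower left corner. -/
structure SelfDualKernel (K K' : Fin 2 → Fin 2 → ℝ → ℝ) (c M : ℝ) : Prop where
  one_le : 1 ≤ M
  tame : ∀ a b, Tame (K' a b) M
  bdd : ∀ a b u, |K a b u| ≤ M
  coef_le : |c| ≤ M
  split : ∀ a b u, K a b u = K' a b u + c * Real.sign u * lowerUnit a b
  dual : ∀ a b u, K a b (-u) = indexSign a * indexSign b * K (1 - b) (1 - a) u

theorem sineKernel_eq (x y : ℝ) : sineKernel x y = sincPi (x - y) := by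
  have : x = y ↔ Real.pi * (x - y) = 0 := by simp [Real.pi_ne_zero, sub_eq_zero]
  simp only [sineKernel, sincPi, Real.sinc_apply, this]

theorem D1_eq (x y : ℝ) : D1 x y = sincPiDeriv (x - y) := by
  simp only [D1, sincPiDeriv, sub_eq_zero]

theorem I1_eq (x y : ℝ) : I1 x y = sincPiTail (x - y) := by
  simp only [I1, sincPiTail, sineKernel_eq, sub_zero]

theorem S4_eq (x y : ℝ) : S4 x y = sincPi (2 * (x - y)) := by
  rw [S4, sineKernel_eq, mul_sub]

theorem D4_eq (x y : ℝ) : D4 x y = 2 * sincPiDeriv (2 * (x - y)) := by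
  rcases eq_or_ne x y with rfl | h
  · simp [D4, sincPiDeriv]
  have h' : x - y ≠ 0 := sub_ne_zero.2 h
  have hpi := Real.pi_ne_zero
  rw [D4, if_neg h, sincPiDeriv, if_neg (by simpa using h'),
    show Real.pi * (2 * (x - y)) = 2 * Real.pi * (x - y) by ring]
  field_simp

theorem sign_two_mul (u : ℝ) : Real.sign (2 * u) = Real.sign u := by
  rcases lt_trichotomy u 0 with h | rfl | h
  · rw [Real.sign_of_neg h, Real.sign_of_neg (by linarith)]
  · simp
  · rw [Real.sign_of_pos h, Real.sign_of_pos (by linarith)]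

theorem I4_eq (x y : ℝ) :
    I4 x y = 1 / 2 * sincPiTail (2 * (x - y)) + 1 / 4 * Real.sign (x - y) := by
  have := intervalIntegral.integral_comp_mul_left (a := 0) (b := x - y) sincPi two_ne_zero
  rw [mul_zero, smul_eq_mul] at this
  simp only [I4, sincPiTail, sineKernel_eq, sub_zero, this, sign_two_mul]
  ring

theorem exists_common_tame {K' : Fin 2 → Fin 2 → ℝ → ℝ} (h : ∀ a b, ∃ M, Tame (K' a b) M) :
    ∃ M, 1 ≤ M ∧ ∀ a b, Tame (K' a b) M := by
  choose m hm using h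
  have h0 : ∀ a b, 0 ≤ m a b := fun a b => (abs_nonneg _).trans ((hm a b).bdd 0)
  have hsum : 0 ≤ ∑ a, ∑ b, m a b :=
    Finset.sum_nonneg fun a _ => Finset.sum_nonneg fun b _ => h0 a b
  refine ⟨1 + ∑ a, ∑ b, m a b, by linarith, fun a b => (hm a b).mono ?_⟩
  have h1 : m a b ≤ ∑ b, m a b :=
    Finset.single_le_sum (fun b _ => h0 a b) (Finset.mem_univ b)
  have h2 : ∑ b, m a b ≤ ∑ a, ∑ b, m a b :=
    Finset.single_le_sum (f := fun a => ∑ b, m a b)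
      (fun a _ => Finset.sum_nonneg fun b _ => h0 a b) (Finset.mem_univ a)
  linarith

theorem SelfDualKernel.of_tame {K K' : Fin 2 → Fin 2 → ℝ → ℝ} {c : ℝ}
    (ht : ∀ a b, ∃ M, Tame (K' a b) M)
    (hs : ∀ a b u, K a b u = K' a b u + c * Real.sign u * lowerUnit a b)
    (hd : ∀ a b u, K a b (-u) = indexSign a * indexSign b * K (1 - b) (1 - a) u) :
    ∃ M, SelfDualKernel K K' c M := by
  obtain ⟨M, hM, h⟩ := exists_common_tame ht
  have hc := abs_nonneg c
  refine ⟨M + |c|, by linarith, fun a b => (h a b).mono (by linarith), fun a b u => ?_,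
    by linarith, hs, hd⟩
  rw [hs]
  refine (abs_add_le _ _).trans (add_le_add ((h a b).bdd u) ?_)
  rw [abs_mul, abs_mul, mul_assoc]
  refine mul_le_of_le_one_right hc (mul_le_one₀ (abs_sign_le_one u) (abs_nonneg _) ?_)
  rw [lowerUnit]
  split_ifs <;> simp

theorem sincPiDeriv_neg (u : ℝ) : sincPiDeriv (-u) = -sincPiDeriv u := by
  simp only [sincPiDeriv, neg_eq_zero]
  split_ifs with h
  · simp
  · rw [mul_neg, Real.cos_neg, Real.sin_neg, neg_sq, ← neg_div]
    ring_nf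

theorem exists_selfDualKernel_K1mat : ∃ K K' c M, SelfDualKernel K K' c M ∧
    ∀ x y a b, K1mat x y a b = K a b (x - y) := by
  let K : Fin 2 → Fin 2 → ℝ → ℝ := ![![sincPi, sincPiDeriv], ![sincPiTail, sincPi]]
  obtain ⟨M, hM⟩ := SelfDualKernel.of_tame (K := K) (K' := K) (c := 0)
    (by
      intro a b
      fin_cases a <;> fin_cases b
      exacts [exists_tame_sincPi, exists_tame_sincPiDeriv, exists_tame_sincPiTail,
        exists_tame_sincPi])
    (by simp)
    (by
      intro a b u
      fin_cases a <;> fin_cases b <;>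
        simp [K, indexSign, sincPi_neg, sincPiDeriv_neg, sincPiTail_neg])
  refine ⟨K, K, 0, M, hM, fun x y a b => ?_⟩
  fin_cases a <;> fin_cases b <;> simp [K, K1mat, sineKernel_eq, D1_eq, I1_eq]
  rw [← sincPi_neg, neg_sub]

theorem exists_selfDualKernel_K4mat : ∃ K K' c M, SelfDualKernel K K' c M ∧
    ∀ x y a b, K4mat x y a b = K a b (x - y) := by
  let K' : Fin 2 → Fin 2 → ℝ → ℝ :=
    ![![fun u => 1 * sincPi (2 * u), fun u => 2 * sincPiDeriv (2 * u)],
      ![fun u => 1 / 2 * sincPiTail (2 * u), fun u => 1 * sincPi (2 * u)]]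
  obtain ⟨m₁, h₁⟩ := exists_tame_sincPi
  obtain ⟨m₂, h₂⟩ := exists_tame_sincPiDeriv
  obtain ⟨m₃, h₃⟩ := exists_tame_sincPiTail
  obtain ⟨M, hM⟩ := SelfDualKernel.of_tame (K' := K') (c := 1 / 4)
    (K := fun a b u => K' a b u + 1 / 4 * Real.sign u * lowerUnit a b)
    (by
      intro a b
      fin_cases a <;> fin_cases b
      exacts [h₁.comp_two_mul 1, h₂.comp_two_mul 2, h₃.comp_two_mul (1 / 2), h₁.comp_two_mul 1])
    (fun _ _ _ => rfl)
    (by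
      intro a b u
      fin_cases a <;> fin_cases b <;>
        simp [K', indexSign, lowerUnit, sincPi_neg, sincPiDeriv_neg, sincPiTail_neg,
          Real.sign_neg]
      ring)
  refine ⟨_, K', 1 / 4, M, hM, fun x y a b => ?_⟩
  fin_cases a <;> fin_cases b <;> simp [K', K4mat, lowerUnit, S4_eq, D4_eq, I4_eq]
  rw [← sincPi_neg, mul_sub, mul_sub, neg_sub]

theorem abs_integral_le_of_integral_update_le {V : Type*} [Fintype V] [DecidableEq V]
    {f : (V → ℝ) → ℝ} (hf : Integrable f) (w : V) (C : ℝ) (φ : V → ℝ → ℝ)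
    (hφ : ∀ i, Integrable (φ i))
    (h : ∀ t, |∫ y, f (Function.update t w y)| ≤ C * ∏ i : {i // ¬ i = w}, φ i (t i)) :
    |∫ t, f t| ≤ C * ∏ i : {i // ¬ i = w}, ∫ y, φ i y := by
  let q : V → Prop := fun i => ¬ i = w
  let e := MeasurableEquiv.piEquivPiSubtypeProd (fun _ : V => ℝ) q
  have he : MeasurePreserving e.symm :=
    (volume_preserving_piEquivPiSubtypeProd (fun _ : V => ℝ) q).symm e
  let _ : Unique {i // ¬ q i} := ⟨⟨⟨w, fun h => h rfl⟩⟩, fun i => Subtype.ext (not_not.1 i.2)⟩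
  have hint : Integrable (fun z => f (e.symm z)) (volume.prod volume) :=
    he.integrable_comp_emb e.symm.measurableEmbedding |>.2 hf
  have h1 : ∫ t, f t = ∫ s, ∫ x, f (e.symm (s, x)) := by
    rw [← he.integral_comp' f]
    exact integral_prod _ hint
  have h2 : ∀ s, ∫ x, f (e.symm (s, x)) =
      ∫ y, f (Function.update (e.symm (s, fun _ => 0)) w y) := by
    intro s
    have hu := (volume_preserving_piUnique fun _ : {i // ¬ q i} => ℝ).symm
    rw [← hu.integral_comp']
    congr 1 with y
    congr 1
    ext i
    by_cases hi : i = w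
    · subst hi
      simp [e, q, MeasurableEquiv.piEquivPiSubtypeProd, Equiv.piEquivPiSubtypeProd,
        MeasurableEquiv.piUnique]
    · simp [e, q, MeasurableEquiv.piEquivPiSubtypeProd, Equiv.piEquivPiSubtypeProd, hi]
  have h3 : Integrable fun s : {i // ¬ i = w} → ℝ =>
      C * ∏ i : {i // ¬ i = w}, φ i (s i) :=
    (Integrable.fintype_prod (f := fun i : {i // ¬ i = w} => φ i) fun i => hφ i).const_mul C
  rw [h1, ← Real.norm_eq_abs]
  refine (norm_integral_le_of_norm_le h3 (ae_of_all _ fun s => ?_)).trans (le_of_eq ?_)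
  · rw [h2, Real.norm_eq_abs]
    refine (h _).trans (le_of_eq ?_)
    congr 1
    refine Finset.prod_congr rfl fun i _ => ?_
    simp [e, q, MeasurableEquiv.piEquivPiSubtypeProd, Equiv.piEquivPiSubtypeProd, i.2]
  · rw [integral_const_mul]
    congr 1
    exact integral_fintype_prod_volume_eq_prod fun i : {i // ¬ i = w} => φ i

theorem measurePreserving_shear {V : Type*} [Fintype V] [DecidableEq V] (v w : V)
    (r : V → Prop) [DecidablePred r] :
    MeasurePreserving fun (t : V → ℝ) i =>
      if i = v ∨ i = w then t i else t i + if r i then t v else t w := by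
  let q : V → Prop := fun i => i = v ∨ i = w
  let e := MeasurableEquiv.piEquivPiSubtypeProd (fun _ : V => ℝ) q
  have he : MeasurePreserving e := volume_preserving_piEquivPiSubtypeProd (fun _ : V => ℝ) q
  let g : ({i // q i} → ℝ) → ({i // ¬ q i} → ℝ) → ({i // ¬ q i} → ℝ) := fun x z =>
    z + fun i : {i // ¬ q i} => if r i then x ⟨v, Or.inl rfl⟩ else x ⟨w, Or.inr rfl⟩
  have hg : Measurable (Function.uncurry g) := by
    refine measurable_pi_lambda _ fun i => ?_
    simp only [Function.uncurry, g, Pi.add_apply]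
    split_ifs <;> fun_prop
  have hs := (MeasurePreserving.id (volume : Measure ({i // q i} → ℝ))).skew_product
    (μc := (volume : Measure ({i // ¬ q i} → ℝ))) (μd := volume) hg
    (ae_of_all _ fun x => map_add_right_eq_self volume _)
  have key := (he.symm e).comp (hs.comp he)
  convert! key using 1

theorem prod_subtype_ne_ite {V : Type*} [Fintype V] [DecidableEq V] {v w : V} (hvw : v ≠ w)
    (x y : ℝ) : ∏ i : {i // ¬ i = w}, (if (i : V) = v then x else y) =
      x * y ^ (Fintype.card V - 2) := by
  rw [← Finset.prod_subtype (Finset.univ.erase w) (by simp) (fun i => if i = v then x else y),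
    ← Finset.mul_prod_erase _ _ (show v ∈ Finset.univ.erase w by simp [hvw]), if_pos rfl,
    Finset.prod_congr rfl (fun i hi => if_neg (Finset.ne_of_mem_erase hi)), Finset.prod_const,
    Finset.card_erase_of_mem (by simp [hvw]), Finset.card_erase_of_mem (Finset.mem_univ _),
    Finset.card_univ, Nat.sub_sub]

/-- If moving the coordinates outside `r` simultaneously has a bounded effect, the
integral of a function supported where the two groups `r`, `¬ r` are localized near
`v`, `w` is bounded. -/
theorem abs_integral_le_of_integral_translate_le {V : Type*} [Fintype V] [DecidableEq V]
    {F : (V → ℝ) → ℝ} (hF : Integrable F) {v w : V} {r : V → Prop} [DecidablePred r]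
    (hv : r v) (hw : ¬ r w) {a b α C : ℝ} (hab : a ≤ b) (hα : 0 ≤ α) (hC : 0 ≤ C)
    (htr : ∀ t : V → ℝ, |∫ y, F (fun i => t i + if r i then 0 else y)| ≤ C)
    (hsupp : ∀ t, F t ≠ 0 → t v ∈ Set.Icc a b ∧ ∀ i, |t i - t (if r i then v else w)| ≤ α) :
    |∫ t, F t| ≤ C * ((b - a) * (2 * α) ^ (Fintype.card V - 2)) := by
  have hvw : v ≠ w := fun h => hw (h ▸ hv)
  let Φ : (V → ℝ) → V → ℝ := fun t i =>
    if i = v ∨ i = w then t i else t i + if r i then t v else t w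
  have hΦ : MeasurePreserving Φ := measurePreserving_shear v w r
  let φ : V → ℝ → ℝ := fun i =>
    if i = v then (Set.Icc a b).indicator 1 else (Set.Icc (-α) α).indicator 1
  have hφ : ∀ i, Integrable (φ i) := by
    intro i
    simp only [φ]
    split_ifs <;>
      exact (integrable_indicator_iff measurableSet_Icc).2 (integrableOn_const (by simp))
  have hφ0 : ∀ i y, 0 ≤ φ i y := by
    intro i y
    simp only [φ]
    split_ifs <;> exact Set.indicator_nonneg (fun _ _ => zero_le_one) _
  have hφint : ∀ i, ∫ y, φ i y = if i = v then b - a else 2 * α := by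
    intro i
    simp only [φ]
    split_ifs
    · rw [integral_indicator_one measurableSet_Icc]
      simp [hab]
    · rw [integral_indicator_one measurableSet_Icc]
      simp [hα, two_mul]
  have hcomp : ∫ t, F t = ∫ t, F (Φ t) := by
    rw [← integral_map hΦ.aemeasurable (by rw [hΦ.map_eq]; exact hF.aestronglyMeasurable),
      hΦ.map_eq]
  have hint : Integrable fun t => F (Φ t) := hΦ.integrable_comp_of_integrable hF
  have hline : ∀ t y, Φ (Function.update t w y) =
      fun i => Φ (Function.update t w 0) i + if r i then 0 else y := by
    intro t y
    ext i
    by_cases hi : i = w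
    · subst hi
      simp [Φ, hw]
    · by_cases hiv : i = v
      · subst hiv
        simp [Φ, hv, hi]
      · by_cases hri : r i <;> simp [Φ, hi, hiv, hri, hvw]
  rw [hcomp]
  refine (abs_integral_le_of_integral_update_le hint w C φ hφ fun t => ?_).trans (le_of_eq ?_)
  · by_cases hne : ∃ y, F (Φ (Function.update t w y)) ≠ 0
    · obtain ⟨y, hy⟩ := hne
      obtain ⟨h1, h2⟩ := hsupp _ hy
      have hone : ∏ i : {i // ¬ i = w}, φ i (t i) = 1 := by
        refine Finset.prod_eq_one fun i _ => ?_
        by_cases hiv : (i : V) = v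
        · have : t v ∈ Set.Icc a b := by simpa [Φ, hvw] using h1
          simp only [φ, hiv, if_true, Set.indicator_of_mem this, Pi.one_apply]
        · have h3 := h2 i
          have : t i ∈ Set.Icc (-α) α := by
            have hiw := i.2
            rw [Set.mem_Icc, ← abs_le]
            by_cases hri : r i
            · simpa [Φ, hri, hiw, hiv, hvw] using h3
            · simpa [Φ, hri, hiw, hiv, hvw] using h3
          simp only [φ, hiv, if_false, Set.indicator_of_mem this, Pi.one_apply]
      rw [hone, mul_one]
      rw [integral_congr_ae (ae_of_all _ fun y => congrArg F (hline t y))]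
      exact htr _
    · push Not at hne
      simp only [hne, integral_zero, abs_zero]
      exact mul_nonneg hC (Finset.prod_nonneg fun i _ => hφ0 _ _)
  · simp_rw [hφint]
    rw [prod_subtype_ne_ite hvw]

theorem integrable_indicator_of_bounded {V : Type*} [Fintype V] {G : (V → ℝ) → ℝ} {E : Set (V → ℝ)}
    {a b C : ℝ} (hG : Measurable G) (hE : MeasurableSet E)
    (hEA : E ⊆ Set.univ.pi fun _ => Set.Icc a b) (hC : ∀ t, |G t| ≤ C) :
    Integrable (E.indicator G) := by
  rw [integrable_indicator_iff hE]
  refine IntegrableOn.mono_set (t := Set.univ.pi fun _ => Set.Icc a b) ?_ hEA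
  refine Measure.integrableOn_of_bounded (M := C) ?_ hG.aestronglyMeasurable
    (ae_of_all _ hC)
  exact (isCompact_univ_pi fun _ => isCompact_Icc).measure_lt_top.ne

/-- The sign `+1` on the group `q` and `-1` off it. -/
def groupSign {V : Type*} (q : V → Prop) [DecidablePred q] (v : V) : ℝ := if q v then 1 else -1

/-- The factor of the edge `v → τ v` when all edges between the two groups are replaced by
their value at infinity. -/
noncomputable def frozenFactor {V : Type*} (K : Fin 2 → Fin 2 → ℝ → ℝ) (c : ℝ) (τ : Equiv.Perm V)
    (q : V → Prop) [DecidablePred q] (d : V → Fin 2) (t : V → ℝ) (v : V) : ℝ :=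
  if q v ↔ q (τ v) then K (d v) (d (τ v)) (t v - t (τ v))
  else c * groupSign q v * lowerUnit (d v) (d (τ v))

theorem exists_path_of_crossing {V : Type*} [Finite V] (τ : Equiv.Perm V) (q : V → Prop)
    {u : V} (hu : ¬(q u ↔ q (τ u))) :
    ∃ n : ℕ, (∀ j ≤ n, (q ((τ ^ j) (τ u)) ↔ q (τ u))) ∧ ¬(q ((τ ^ (n + 1)) (τ u)) ↔ q (τ u)) := by
  classical
  have hex : ∃ m, ¬(q ((τ ^ m) (τ u)) ↔ q (τ u)) := by
    refine ⟨orderOf τ - 1, ?_⟩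
    rw [← Equiv.Perm.mul_apply, ← pow_succ, Nat.sub_add_cancel (orderOf_pos τ), pow_orderOf_eq_one]
    exact hu
  obtain ⟨n, hn⟩ : ∃ n, Nat.find hex = n + 1 := by
    refine Nat.exists_eq_succ_of_ne_zero fun h => ?_
    have := Nat.find_spec hex
    simp [h] at this
  refine ⟨n, fun j hj => ?_, hn ▸ Nat.find_spec hex⟩
  by_contra h
  have := Nat.find_min' hex h
  omega

theorem prod_mul_succ_of_sq {s : ℕ → ℝ} (hs : ∀ i, s i * s i = 1) (n : ℕ) :
    ∏ m ∈ Finset.range n, s (m + 1) * s m = s n * s 0 := by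
  induction n with
  | zero => simp [hs]
  | succ n ih =>
    rw [Finset.prod_range_succ, ih]
    linear_combination s (n + 1) * s 0 * hs n

theorem one_sub_one_sub_fin_two (a : Fin 2) : 1 - (1 - a) = a := by
  fin_cases a <;> rfl

theorem indexSign_mul_self (a : Fin 2) : indexSign a * indexSign a = 1 := by
  fin_cases a <;> simp [indexSign]

theorem indexSign_mul_lowerUnit_flip (x y b u : Fin 2) :
    indexSign (1 - y) * indexSign (1 - x) * (lowerUnit (1 - x) b * lowerUnit u (1 - y)) =
      -(lowerUnit y b * lowerUnit u x) := by
  fin_cases x <;> fin_cases y <;> fin_cases b <;> fin_cases u <;> simp [lowerUnit, indexSign]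

theorem exists_path_reversal {V : Type*} [DecidableEq V] {p : ℕ → V} {n : ℕ}
    (hp : ∀ i ≤ n, ∀ j ≤ n, p i = p j → i = j) :
    ∃ ρ : Equiv.Perm V, (∀ j ≤ n, ρ (p j) = p (n - j)) ∧
      (∀ v, (∀ j ≤ n, p j ≠ v) → ρ v = v) ∧ ∀ v, ρ (ρ v) = v := by
  classical
  let f : V → V := fun v => if h : ∃ j, j ≤ n ∧ p j = v then p (n - h.choose) else v
  have hf : ∀ j ≤ n, f (p j) = p (n - j) := by
    intro j hj
    have h : ∃ i, i ≤ n ∧ p i = p j := ⟨j, hj, rfl⟩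
    have := hp _ h.choose_spec.1 j hj h.choose_spec.2
    simp only [f]
    rw [dif_pos h, this]
  have hf' : ∀ v, (∀ j ≤ n, p j ≠ v) → f v = v := by
    intro v hv
    refine dif_neg ?_
    rintro ⟨j, hj, h⟩
    exact hv j hj h
  have hinv : Function.Involutive f := by
    intro v
    by_cases h : ∃ j, j ≤ n ∧ p j = v
    · obtain ⟨j, hj, rfl⟩ := h
      rw [hf j hj, hf _ (Nat.sub_le _ _), Nat.sub_sub_self hj]
    · push Not at h
      rw [hf' v h, hf' v h]
  exact ⟨hinv.toPerm, hf, hf', hinv⟩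

/-- Reversing a path between two consecutive crossings changes the sign of the frozen product. -/
theorem exists_sign_reversing {V : Type*} [Fintype V] [DecidableEq V]
    {K K' : Fin 2 → Fin 2 → ℝ → ℝ} {c M : ℝ} (hK : SelfDualKernel K K' c M) (τ : Equiv.Perm V)
    (q : V → Prop) [DecidablePred q] {u : V} (hu : ¬(q u ↔ q (τ u))) :
    ∃ (ρ : Equiv.Perm V) (δ : Equiv.Perm (V → Fin 2)), (∀ v, q (ρ v) ↔ q v) ∧
      ∀ d t, ∏ v, frozenFactor K c τ q (δ d) (t ∘ ρ) v = -∏ v, frozenFactor K c τ q d t v := by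
  obtain ⟨n, hin, hout⟩ := exists_path_of_crossing τ q hu
  set p : ℕ → V := fun j => (τ ^ j) (τ u) with hpdef
  have hp0 : p 0 = τ u := rfl
  have hτp : ∀ j, τ (p j) = p (j + 1) := fun j => by
    simp only [hpdef, pow_succ', Equiv.Perm.mul_apply]
  have hup : ∀ j ≤ n, p j ≠ u := by
    intro j hj h
    have := hin j hj
    change q (p j) ↔ _ at this
    rw [h] at this
    exact hu this
  have hshift : ∀ i k, p i = p (i + k) → p k = p 0 := by
    intro i k h
    have h2 : p (i + k) = (τ ^ i) (p k) := by
      simp only [hpdef, pow_add, Equiv.Perm.mul_apply]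
    rw [h2] at h
    exact ((τ ^ i).injective h).symm
  have hinj : ∀ i ≤ n, ∀ j ≤ n, p i = p j → i = j := by
    have aux : ∀ i k, i + k ≤ n → p i = p (i + k) → k = 0 := by
      intro i k hk h
      by_contra hne
      obtain ⟨k', rfl⟩ := Nat.exists_eq_succ_of_ne_zero hne
      have h3 := hshift i _ h
      rw [Nat.succ_eq_add_one, ← hτp, hp0] at h3
      exact hup k' (by omega) (τ.injective h3)
    intro i hi j hj h
    rcases le_total i j with hij | hij
    · obtain ⟨k, rfl⟩ := Nat.exists_eq_add_of_le hij
      have := aux i k hj h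
      omega
    · obtain ⟨k, rfl⟩ := Nat.exists_eq_add_of_le hij
      have := aux j k hi h.symm
      omega
  obtain ⟨ρ, hρ, hρ', hρρ⟩ := exists_path_reversal hinj
  let S : Finset V := (Finset.range (n + 1)).image p
  have hS : ∀ v, v ∈ S ↔ ∃ j ≤ n, p j = v := by
    intro v
    simp [S]
  have hρS : ∀ v, v ∉ S → ρ v = v := fun v hv => hρ' v fun j hj h => hv ((hS v).2 ⟨j, hj, h⟩)
  have hpS : ∀ j ≤ n, p j ∈ S := fun j hj => (hS _).2 ⟨j, hj, rfl⟩
  have hSρ : ∀ v, v ∈ S → ρ v ∈ S := by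
    intro v hv
    obtain ⟨j, hj, rfl⟩ := (hS v).1 hv
    rw [hρ j hj]
    exact hpS _ (Nat.sub_le _ _)
  let δ : (V → Fin 2) → V → Fin 2 := fun d v => if v ∈ S then 1 - d (ρ v) else d v
  have hδ : Function.Involutive δ := by
    intro d
    ext v
    by_cases hv : v ∈ S
    · simp [δ, hv, hSρ v hv, hρρ]
    · simp [δ, hv]
  refine ⟨ρ, hδ.toPerm, ?_, ?_⟩
  · intro v
    by_cases hv : v ∈ S
    · obtain ⟨j, hj, rfl⟩ := (hS v).1 hv
      rw [hρ j hj]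
      exact (hin _ (Nat.sub_le _ _)).trans (hin j hj).symm
    · rw [hρS v hv]
  intro d t
  change ∏ v, frozenFactor K c τ q (δ d) (t ∘ ρ) v = _
  have huS : u ∉ S := fun h => by
    obtain ⟨j, hj, h⟩ := (hS u).1 h
    exact hup j hj h
  have hendS : p (n + 1) ∉ S := fun h => by
    obtain ⟨j, hj, h⟩ := (hS _).1 h
    refine hout ?_
    change q (p (n + 1)) ↔ _
    rw [← h]
    exact hin j hj
  have hsplit : ∀ F : V → ℝ, ∏ v, F v =
      (∏ j ∈ Finset.range n, F (p j)) * (F (p n) * F u) * ∏ v ∈ (insert u S)ᶜ, F v := by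
    intro F
    rw [← Finset.prod_mul_prod_compl (insert u S), Finset.prod_insert huS,
      Finset.prod_image (fun i hi j hj h => hinj i (by simpa [Nat.lt_succ_iff] using hi) j
        (by simpa [Nat.lt_succ_iff] using hj) h), Finset.prod_range_succ]
    ring
  rw [hsplit, hsplit]
  have hrest : ∏ v ∈ (insert u S)ᶜ, frozenFactor K c τ q (δ d) (t ∘ ρ) v =
      ∏ v ∈ (insert u S)ᶜ, frozenFactor K c τ q d t v := by
    refine Finset.prod_congr rfl fun v hv => ?_
    rw [Finset.mem_compl, Finset.mem_insert, not_or] at hv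
    have hτv : τ v ∉ S := fun h => by
      obtain ⟨j, hj, h⟩ := (hS _).1 h
      cases j with
      | zero => exact hv.1 (τ.injective h).symm
      | succ j =>
        rw [← hτp] at h
        exact hv.2 ((hS _).2 ⟨j, by omega, τ.injective h⟩)
    simp [frozenFactor, δ, hv.2, hτv, hρS]
  have hδp : ∀ j ≤ n, δ d (p j) = 1 - d (p (n - j)) := by
    intro j hj
    simp [δ, hpS j hj, hρ j hj]
  let s : ℕ → ℝ := fun m => indexSign (1 - d (p m))
  have hinner : ∏ j ∈ Finset.range n, frozenFactor K c τ q (δ d) (t ∘ ρ) (p j) =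
      s n * s 0 * ∏ j ∈ Finset.range n, frozenFactor K c τ q d t (p j) := by
    rw [← prod_mul_succ_of_sq (s := s) (fun i => indexSign_mul_self _) n, ← Finset.prod_mul_distrib,
      ← Finset.prod_range_reflect]
    refine Finset.prod_congr rfl fun m hm => ?_
    rw [Finset.mem_range] at hm
    have e1 : ∀ i < n, (q (p i) ↔ q (τ (p i))) := by
      intro i hi
      rw [hτp]
      exact (hin i (by omega)).trans (hin (i + 1) (by omega)).symm
    rw [frozenFactor, frozenFactor, if_pos (e1 _ (by omega)), if_pos (e1 _ hm), hτp, hτp,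
      hδp _ (by omega), hδp _ (by omega), Function.comp_apply, Function.comp_apply,
      hρ (n - 1 - m) (by omega), hρ (n - 1 - m + 1) (by omega),
      show n - (n - 1 - m) = m + 1 by omega, show n - (n - 1 - m + 1) = m by omega,
      ← neg_sub (t (p m)), hK.dual, one_sub_one_sub_fin_two, one_sub_one_sub_fin_two]
  have hends : s n * s 0 * (frozenFactor K c τ q (δ d) (t ∘ ρ) (p n) *
      frozenFactor K c τ q (δ d) (t ∘ ρ) u) =
      -(frozenFactor K c τ q d t (p n) * frozenFactor K c τ q d t u) := by
    have e1 : ¬(q (p n) ↔ q (τ (p n))) := by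
      rw [hτp, hin n le_rfl]
      exact fun h => hout h.symm
    simp only [frozenFactor, if_neg e1, if_neg hu]
    rw [hτp, ← hp0, hδp n le_rfl, hδp 0 (by omega), Nat.sub_self, Nat.sub_zero,
      show δ d u = d u from if_neg huS, show δ d (p (n + 1)) = d (p (n + 1)) from if_neg hendS]
    linear_combination (c * groupSign q (p n) * (c * groupSign q u)) *
      indexSign_mul_lowerUnit_flip (d (p 0)) (d (p n)) (d (p (n + 1))) (d u)
  rw [hrest, hinner]
  linear_combination (∏ j ∈ Finset.range n, frozenFactor K c τ q d t (p j)) *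
    (∏ v ∈ (insert u S)ᶜ, frozenFactor K c τ q d t v) * hends

theorem sum_integral_frozen_eq_zero {V : Type*} [Fintype V] [DecidableEq V]
    {K K' : Fin 2 → Fin 2 → ℝ → ℝ} {c M : ℝ} (hK : SelfDualKernel K K' c M) (τ : Equiv.Perm V)
    (q : V → Prop) [DecidablePred q] {u : V} (hu : ¬(q u ↔ q (τ u))) {E : Set (V → ℝ)}
    (hE : ∀ ρ : Equiv.Perm V, (∀ v, q (ρ v) ↔ q v) → ∀ t, t ∘ ρ ∈ E ↔ t ∈ E) :
    ∑ d : V → Fin 2, ∫ t, E.indicator (fun t => ∏ v, frozenFactor K c τ q d t v) t = 0 := by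
  obtain ⟨ρ, δ, hρ, h⟩ := exists_sign_reversing hK τ q hu
  have hmp := volume_measurePreserving_piCongrLeft (fun _ : V => ℝ) ρ.symm
  have key : ∑ d : V → Fin 2, ∫ t, E.indicator (fun t => ∏ v, frozenFactor K c τ q d t v) t =
      -∑ d : V → Fin 2, ∫ t, E.indicator (fun t => ∏ v, frozenFactor K c τ q d t v) t := by
    conv_lhs => rw [← Equiv.sum_comp δ]
    rw [← Finset.sum_neg_distrib]
    refine Finset.sum_congr rfl fun d _ => ?_
    rw [← hmp.integral_comp', ← integral_neg]
    congr 1 with t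
    have e : MeasurableEquiv.piCongrLeft (fun _ : V => ℝ) ρ.symm t = t ∘ ρ := by
      ext v
      simp [MeasurableEquiv.piCongrLeft, Equiv.piCongrLeft, Equiv.piCongrLeft']
    rw [e]
    by_cases ht : t ∈ E
    · rw [Set.indicator_of_mem ht, Set.indicator_of_mem ((hE ρ hρ t).2 ht), h]
    · rw [Set.indicator_of_notMem ht, Set.indicator_of_notMem (fun h' => ht ((hE ρ hρ t).1 h')),
        neg_zero]
  linarith

theorem Tame.abs_setIntegral_le {f : ℝ → ℝ} {M : ℝ} (hf : Tame f M) {J : Set ℝ}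
    (hJ : J.OrdConnected) {x y : ℝ} (hxy : J ⊆ Set.Icc x y) : |∫ u in J, f u| ≤ M := by
  rcases J.eq_empty_or_nonempty with rfl | hne
  · simpa using (abs_nonneg _).trans (hf.bdd 0)
  have hb : BddBelow J := bddBelow_Icc.mono hxy
  have ha : BddAbove J := bddAbove_Icc.mono hxy
  have h1 : Set.Ioo (sInf J) (sSup J) ⊆ J :=
    IsConnected.Ioo_csInf_csSup_subset ⟨hne, isPreconnected_iff_ordConnected.2 hJ⟩ hb ha
  have h2 : J ⊆ Set.Icc (sInf J) (sSup J) :=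
    fun u hu => ⟨csInf_le hb hu, le_csSup ha hu⟩
  have h3 : J =ᵐ[volume] Set.Ioc (sInf J) (sSup J) :=
    (h2.eventuallyLE.trans Ioc_ae_eq_Icc.symm.le).antisymm
      (Ioo_ae_eq_Ioc.symm.le.trans h1.eventuallyLE)
  rw [setIntegral_congr_set h3, ← intervalIntegral.integral_of_le
    ((csInf_le hb hne.some_mem).trans (le_csSup ha hne.some_mem))]
  exact hf.osc _ _

theorem Tame.comp_sub_left {f : ℝ → ℝ} {M : ℝ} (hf : Tame f M) (s : ℝ) :
    Tame (fun y => f (s - y)) M where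
  meas := hf.meas.comp (measurable_const.sub measurable_id)
  bdd u := hf.bdd _
  sq_int := hf.sq_int.comp_sub_left s
  sq_le := by
    rw [integral_sub_left_eq_self (fun u => f u ^ 2)]
    exact hf.sq_le
  osc x y := by
    rw [intervalIntegral.integral_comp_sub_left f]
    exact hf.osc _ _

theorem Tame.comp_add_left {f : ℝ → ℝ} {M : ℝ} (hf : Tame f M) (s : ℝ) :
    Tame (fun y => f (s + y)) M where
  meas := hf.meas.comp (measurable_const.add measurable_id)
  bdd u := hf.bdd _
  sq_int := hf.sq_int.comp_add_left s
  sq_le := by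
    rw [integral_add_left_eq_self (fun u => f u ^ 2)]
    exact hf.sq_le
  osc x y := by
    rw [intervalIntegral.integral_comp_add_left f]
    exact hf.osc _ _

/-- The factor of a crossing edge `v → τ v` after its value at infinity has been removed. -/
noncomputable def tailFactor {V : Type*} (K' : Fin 2 → Fin 2 → ℝ → ℝ) (τ : Equiv.Perm V)
    (q : V → Prop) [DecidablePred q] (d : V → Fin 2) (t : V → ℝ) (v : V) : ℝ :=
  if q v ↔ q (τ v) then 0 else K' (d v) (d (τ v)) (t v - t (τ v))

/-- The configurations in `[a, b]` for which both groups have diameter less than `α`. -/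
def clusterSet {V : Type*} (p : V → Prop) (a b α : ℝ) : Set (V → ℝ) :=
  {t | (∀ i, t i ∈ Set.Icc a b) ∧ ∀ i j, (p i ↔ p j) → t i - t j < α}

/-- The configurations for which the group `q` lies above the other one. -/
def aboveSet {V : Type*} (q : V → Prop) : Set (V → ℝ) :=
  {t | ∀ i j, q i → ¬ q j → t j < t i}

section Factors

variable {V : Type*} {K K' : Fin 2 → Fin 2 → ℝ → ℝ} {c M : ℝ}

theorem SelfDualKernel.pos (hK : SelfDualKernel K K' c M) : 0 < M :=
  one_pos.trans_le hK.one_le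

theorem SelfDualKernel.measurable (hK : SelfDualKernel K K' c M) (a b : Fin 2) :
    Measurable (K a b) := by
  have : K a b = fun u => K' a b u + c * Real.sign u * lowerUnit a b := funext (hK.split a b)
  rw [this]
  exact (hK.tame a b).meas.add ((measurable_sign_real.const_mul c).mul_const _)

theorem abs_frozenFactor_le (hK : SelfDualKernel K K' c M) (τ : Equiv.Perm V) (q : V → Prop)
    [DecidablePred q] (d : V → Fin 2) (t : V → ℝ) (v : V) :
    |frozenFactor K c τ q d t v| ≤ M := by
  unfold frozenFactor
  split_ifs
  · exact hK.bdd _ _ _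
  · have h1 : |groupSign q v| = 1 := by
      unfold groupSign
      split_ifs <;> simp
    have h2 : |lowerUnit (d v) (d (τ v))| ≤ 1 := by
      unfold lowerUnit
      split_ifs <;> simp
    rw [abs_mul, abs_mul, h1, mul_one]
    exact (mul_le_of_le_one_right (abs_nonneg c) h2).trans hK.coef_le

theorem abs_tailFactor_le (hK : SelfDualKernel K K' c M) (τ : Equiv.Perm V) (q : V → Prop)
    [DecidablePred q] (d : V → Fin 2) (t : V → ℝ) (v : V) :
    |tailFactor K' τ q d t v| ≤ M := by
  unfold tailFactor
  split_ifs
  · simpa using hK.pos.le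
  · exact (hK.tame _ _).bdd _

theorem measurable_frozenFactor (hK : SelfDualKernel K K' c M) (τ : Equiv.Perm V) (q : V → Prop)
    [DecidablePred q] (d : V → Fin 2) (v : V) :
    Measurable fun t => frozenFactor K c τ q d t v := by
  unfold frozenFactor
  split_ifs
  · exact (hK.measurable _ _).comp ((measurable_pi_apply v).sub (measurable_pi_apply (τ v)))
  · exact measurable_const

theorem measurable_tailFactor (hK : SelfDualKernel K K' c M) (τ : Equiv.Perm V) (q : V → Prop)
    [DecidablePred q] (d : V → Fin 2) (v : V) :
    Measurable fun t => tailFactor K' τ q d t v := by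
  unfold tailFactor
  split_ifs
  · exact measurable_const
  · exact (hK.tame _ _).meas.comp ((measurable_pi_apply v).sub (measurable_pi_apply (τ v)))

theorem kernel_eq_frozenFactor_add_tailFactor (hK : SelfDualKernel K K' c M) (τ : Equiv.Perm V)
    (q : V → Prop) [DecidablePred q] (d : V → Fin 2) {t : V → ℝ} (ht : t ∈ aboveSet q) (v : V) :
    K (d v) (d (τ v)) (t v - t (τ v)) = tailFactor K' τ q d t v + frozenFactor K c τ q d t v := by
  unfold frozenFactor tailFactor groupSign
  by_cases h : q v ↔ q (τ v)
  · simp [h]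
  rw [if_neg h, if_neg h, hK.split]
  by_cases hv : q v
  · have := ht v (τ v) hv (by tauto)
    rw [if_pos hv, Real.sign_of_pos (by linarith)]
  · have := ht (τ v) v (by tauto) hv
    rw [if_neg hv, Real.sign_of_neg (by linarith)]

theorem abs_prod_le_pow_card {f : V → ℝ} (hf : ∀ v, |f v| ≤ M) (s : Finset V) :
    |∏ v ∈ s, f v| ≤ M ^ s.card := by
  rw [Finset.abs_prod, ← Finset.prod_const]
  exact Finset.prod_le_prod (fun _ _ => abs_nonneg _) fun v _ => hf v

/-- Moving the group opposite to `e` leaves the frozen factors unchanged. -/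
theorem frozenFactor_shift (τ : Equiv.Perm V) (q : V → Prop) [DecidablePred q] (d : V → Fin 2)
    (t : V → ℝ) (e : V) (y : ℝ) (v : V) :
    frozenFactor K c τ q d (fun i => t i + if q i ↔ q e then 0 else y) v =
      frozenFactor K c τ q d t v := by
  unfold frozenFactor
  by_cases h : q v ↔ q (τ v)
  · simp only [h]
    simp
  · rw [if_neg h, if_neg h]

theorem tame_tailFactor_shift (hK : SelfDualKernel K K' c M) (τ : Equiv.Perm V) (q : V → Prop)
    [DecidablePred q] (d : V → Fin 2) (t : V → ℝ) (e : V) {v : V} (hv : ¬(q v ↔ q (τ v))) :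
    Tame (fun y => tailFactor K' τ q d (fun i => t i + if q i ↔ q e then 0 else y) v) M := by
  unfold tailFactor
  simp only [if_neg hv]
  by_cases h : q v ↔ q e
  · convert (hK.tame (d v) (d (τ v))).comp_sub_left (t v - t (τ v)) using 3
    rw [if_pos h, if_neg (by tauto)]
    ring
  · convert (hK.tame (d v) (d (τ v))).comp_add_left (t v - t (τ v)) using 3
    rw [if_neg h, if_pos (by tauto)]
    ring

theorem abs_setIntegral_prod_tailFactor_le [DecidableEq V] (hK : SelfDualKernel K K' c M)
    (τ : Equiv.Perm V) (q : V → Prop) [DecidablePred q] (d : V → Fin 2) (t : V → ℝ) (e : V)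
    {T : Finset V}
    (hT : T.Nonempty) {J : Set ℝ} (hJ : J.OrdConnected) {x x' : ℝ} (hxx : J ⊆ Set.Icc x x') :
    |∫ y in J, ∏ v ∈ T, tailFactor K' τ q d (fun i => t i + if q i ↔ q e then 0 else y) v| ≤
      2 * M ^ T.card := by
  have hM := hK.pos
  by_cases hc : ∃ v ∈ T, q v ↔ q (τ v)
  · obtain ⟨v, hvT, hv⟩ := hc
    have : ∀ t, ∏ v ∈ T, tailFactor K' τ q d t v = 0 := fun t =>
      Finset.prod_eq_zero hvT (if_pos hv)
    simp only [this, integral_zero, abs_zero]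
    positivity
  push Not at hc
  obtain ⟨v, hv⟩ := hT
  rw [← Finset.insert_erase hv]
  have hvt := tame_tailFactor_shift hK τ q d t e (fun h => by have := hc v hv; tauto)
  rcases (T.erase v).eq_empty_or_nonempty with h0 | ⟨w, hw⟩
  · rw [h0]
    simp only [insert_empty_eq, Finset.prod_singleton, Finset.card_singleton, pow_one]
    linarith [hvt.abs_setIntegral_le hJ hxx]
  rw [Finset.card_insert_of_notMem (Finset.notMem_erase _ _), ← Finset.insert_erase hw,
    Finset.card_insert_of_notMem (Finset.notMem_erase _ _)]
  have hwt := tame_tailFactor_shift hK τ q d t e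
    (fun h => by have := hc w (Finset.mem_of_mem_erase hw); tauto)
  set s := (T.erase v).erase w
  have hvs : v ∉ insert w s := by
    rw [Finset.insert_erase hw]
    exact Finset.notMem_erase _ _
  have hint := (hvt.sq_int.add hwt.sq_int).const_mul (M ^ s.card)
  have hMs : 0 ≤ M ^ s.card := by positivity
  have h1 : ∀ y, ‖∏ v ∈ insert v (insert w s),
      tailFactor K' τ q d (fun i => t i + if q i ↔ q e then 0 else y) v‖ ≤
      M ^ s.card * (tailFactor K' τ q d (fun i => t i + if q i ↔ q e then 0 else y) v ^ 2 +
        tailFactor K' τ q d (fun i => t i + if q i ↔ q e then 0 else y) w ^ 2) := by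
    intro y
    rw [Finset.prod_insert hvs, Finset.prod_insert (Finset.notMem_erase _ _), Real.norm_eq_abs,
      ← mul_assoc, abs_mul, mul_comm]
    refine mul_le_mul (abs_prod_le_pow_card (abs_tailFactor_le hK τ q d _) s) ?_
      (abs_nonneg _) hMs
    rw [abs_le]
    constructor <;> nlinarith [sq_nonneg
      (tailFactor K' τ q d (fun i => t i + if q i ↔ q e then 0 else y) v +
        tailFactor K' τ q d (fun i => t i + if q i ↔ q e then 0 else y) w), sq_nonneg
      (tailFactor K' τ q d (fun i => t i + if q i ↔ q e then 0 else y) v -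
        tailFactor K' τ q d (fun i => t i + if q i ↔ q e then 0 else y) w)]
  refine (norm_integral_le_of_norm_le hint.integrableOn (ae_of_all _ h1)).trans ?_
  refine (setIntegral_le_integral hint (ae_of_all _ fun y => ?_)).trans ?_
  · change 0 ≤ M ^ s.card * (_ ^ 2 + _ ^ 2)
    positivity
  · simp only [Pi.add_apply]
    rw [integral_const_mul, integral_add hvt.sq_int hwt.sq_int]
    have h2 := mul_le_mul_of_nonneg_left (add_le_add hvt.sq_le hwt.sq_le) hMs
    have h3 : M ^ s.card * M ≤ M ^ s.card * M * M :=
      le_mul_of_one_le_right (by positivity) hK.one_le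
    calc _ ≤ _ := h2
      _ ≤ _ := by rw [pow_succ, pow_succ]; linarith

end Factors

theorem comp_mem_clusterSet_inter_aboveSet {V : Type*} {q : V → Prop} {a b α : ℝ} {t : V → ℝ}
    (ρ : Equiv.Perm V) (hρ : ∀ v, q (ρ v) ↔ q v) (ht : t ∈ clusterSet q a b α ∩ aboveSet q) :
    t ∘ ρ ∈ clusterSet q a b α ∩ aboveSet q := by
  refine ⟨⟨fun i => ht.1.1 _, fun i j hij => ht.1.2 _ _ ?_⟩, fun i j hi hj => ht.2 _ _ ?_ ?_⟩
  · rwa [hρ, hρ]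
  · rwa [hρ]
  · rwa [hρ]

theorem clusterSet_not {V : Type*} (p : V → Prop) (a b α : ℝ) :
    clusterSet (fun v => ¬ p v) a b α = clusterSet p a b α := by
  simp only [clusterSet, not_iff_not]

section Assembly

variable {V : Type*} [Fintype V]

theorem measurableSet_clusterSet (p : V → Prop) (a b α : ℝ) :
    MeasurableSet (clusterSet p a b α) := by
  have : clusterSet p a b α = (⋂ i, {t | t i ∈ Set.Icc a b}) ∩
      ⋂ i, ⋂ j, ⋂ _ : p i ↔ p j, {t | t i - t j < α} := by
    ext t
    simp [clusterSet]
  rw [this]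
  refine (MeasurableSet.iInter fun i => measurable_pi_apply i measurableSet_Icc).inter
    (MeasurableSet.iInter fun i => MeasurableSet.iInter fun j => MeasurableSet.iInter fun _ => ?_)
  exact measurableSet_lt ((measurable_pi_apply i).sub (measurable_pi_apply j)) measurable_const

theorem measurableSet_aboveSet (q : V → Prop) : MeasurableSet (aboveSet q) := by
  have : aboveSet q = ⋂ i, ⋂ j, ⋂ _ : q i, ⋂ _ : ¬ q j, {t : V → ℝ | t j < t i} := by
    ext t
    simp [aboveSet]
  rw [this]
  refine MeasurableSet.iInter fun i => MeasurableSet.iInter fun j => MeasurableSet.iInter fun _ =>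
    MeasurableSet.iInter fun _ => ?_
  exact measurableSet_lt (measurable_pi_apply j) (measurable_pi_apply i)

variable [DecidableEq V] {K K' : Fin 2 → Fin 2 → ℝ → ℝ} {c M : ℝ}

/-- An integral over a subset of the cluster set is controlled by the integral over the relative
position of the two groups. -/
theorem abs_integral_indicator_le {p : V → Prop} [DecidablePred p] {e w : V} (hw : ¬(p w ↔ p e))
    {a b α C C' : ℝ} (hab : a ≤ b) (hα : 0 ≤ α) (hC : 0 ≤ C) {E : Set (V → ℝ)}
    (hE : MeasurableSet E) (hEp : E ⊆ clusterSet p a b α) {G : (V → ℝ) → ℝ} (hG : Measurable G)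
    (hGC : ∀ t, |G t| ≤ C')
    (htr : ∀ t : V → ℝ, |∫ y in (fun (y : ℝ) i => t i + if p i ↔ p e then 0 else y) ⁻¹' E,
      G (fun i => t i + if p i ↔ p e then 0 else y)| ≤ C) :
    |∫ t, E.indicator G t| ≤ C * ((b - a) * (2 * α) ^ (Fintype.card V - 2)) := by
  refine abs_integral_le_of_integral_translate_le (v := e) (w := w) (r := fun i => p i ↔ p e)
    (integrable_indicator_of_bounded hG hE
      (fun t ht i _ => (hEp ht).1 i) hGC) Iff.rfl hw hab hα hC (fun t => ?_) fun t ht => ?_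
  · refine le_trans (le_of_eq ?_) (htr t)
    have hm : Measurable fun (y : ℝ) (i : V) => t i + if p i ↔ p e then 0 else y := by
      refine measurable_pi_lambda _ fun i => ?_
      split_ifs
      · exact measurable_const
      · exact measurable_const.add measurable_id
    rw [← integral_indicator (hm hE)]
    rfl
  · have htE := hEp (Set.mem_of_indicator_ne_zero ht)
    refine ⟨htE.1 e, fun i => ?_⟩
    have h : p i ↔ p (if p i ↔ p e then e else w) := by
      split_ifs with h
      · exact h
      · tauto
    exact abs_le.2 ⟨by linarith [htE.2 _ _ h.symm], (htE.2 _ _ h).le⟩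

theorem abs_integral_mixed_prod_le (hK : SelfDualKernel K K' c M) (τ : Equiv.Perm V)
    (q : V → Prop) [DecidablePred q] {a b α : ℝ} (hab : a ≤ b) (hα : 0 ≤ α) (d : V → Fin 2)
    {T : Finset V} (hT : T.Nonempty) :
    |∫ t, (clusterSet q a b α ∩ aboveSet q).indicator (fun t =>
      (∏ v ∈ T, tailFactor K' τ q d t v) * ∏ v ∈ Tᶜ, frozenFactor K c τ q d t v) t| ≤
      2 * M ^ Fintype.card V * ((b - a) * (2 * α) ^ (Fintype.card V - 2)) := by
  have hM := hK.pos
  by_cases hc : ∃ v ∈ T, q v ↔ q (τ v)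
  · obtain ⟨v, hvT, hv⟩ := hc
    have : ∀ t, ∏ v ∈ T, tailFactor K' τ q d t v = 0 := fun t =>
      Finset.prod_eq_zero hvT (if_pos hv)
    simp only [this, zero_mul, Set.indicator_zero, integral_zero, abs_zero]
    have := sub_nonneg.2 hab
    positivity
  push Not at hc
  obtain ⟨e, he⟩ := hT
  refine abs_integral_indicator_le (e := e) (w := τ e) (C' := M ^ T.card * M ^ Tᶜ.card)
    (by have := hc e he; tauto) hab hα (by positivity)
    ((measurableSet_clusterSet q a b α).inter (measurableSet_aboveSet q)) Set.inter_subset_left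
    ((Finset.measurable_prod _ fun v _ => measurable_tailFactor hK τ q d v).mul
      (Finset.measurable_prod _ fun v _ => measurable_frozenFactor hK τ q d v))
    (fun t => ?_) fun t => ?_
  · rw [abs_mul]
    exact mul_le_mul (abs_prod_le_pow_card (abs_tailFactor_le hK τ q d t) T)
      (abs_prod_le_pow_card (abs_frozenFactor_le hK τ q d t) Tᶜ) (abs_nonneg _) (by positivity)
  · simp only [frozenFactor_shift]
    rw [integral_mul_const, abs_mul, ← Finset.card_add_card_compl T, pow_add, ← mul_assoc]
    refine mul_le_mul (abs_setIntegral_prod_tailFactor_le hK τ q d t e ⟨e, he⟩ ?_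
      (x := a - t (τ e)) (x' := b - t (τ e)) ?_)
      (abs_prod_le_pow_card (abs_frozenFactor_le hK τ q d t) Tᶜ) (abs_nonneg _) (by positivity)
    · refine ⟨fun y hy z hz x hx => ⟨⟨fun i => ?_, fun i j hij => ?_⟩, fun i j hi hj => ?_⟩⟩
      · have h1 := hy.1.1 i
        have h2 := hz.1.1 i
        simp only [Set.mem_Icc] at h1 h2 hx ⊢
        split_ifs at h1 h2 ⊢ <;> constructor <;> linarith
      · have h1 := hy.1.2 i j hij
        simp only [hij] at h1 ⊢
        linarith
      · have h1 := hy.2 i j hi hj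
        have h2 := hz.2 i j hi hj
        simp only [Set.mem_Icc, hi, hj, true_iff, false_iff] at h1 h2 hx ⊢
        split_ifs at h1 h2 ⊢ <;> linarith
    · intro y hy
      have h1 := hy.1.1 (τ e)
      simp only [if_neg (show ¬(q (τ e) ↔ q e) by have := hc e he; tauto), Set.mem_Icc] at h1
      constructor <;> linarith

/-- The separated region contributes no more than the relative position can: the fully frozen
part cancels in the sum over the matrix indices. -/
theorem abs_sum_integral_above_le (hK : SelfDualKernel K K' c M) (τ : Equiv.Perm V)
    (q : V → Prop) [DecidablePred q] {u : V} (hu : ¬(q u ↔ q (τ u))) {a b α : ℝ} (hab : a ≤ b)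
    (hα : 0 ≤ α) :
    |∑ d : V → Fin 2, ∫ t, (clusterSet q a b α ∩ aboveSet q).indicator
      (fun t => ∏ v, K (d v) (d (τ v)) (t v - t (τ v))) t| ≤
      2 * 4 ^ Fintype.card V * M ^ Fintype.card V *
        ((b - a) * (2 * α) ^ (Fintype.card V - 2)) := by
  set E := clusterSet q a b α ∩ aboveSet q with hEdef
  have hE : MeasurableSet E := (measurableSet_clusterSet q a b α).inter (measurableSet_aboveSet q)
  have hM := hK.pos
  let G : (V → Fin 2) → Finset V → (V → ℝ) → ℝ := fun d T t =>
    (∏ v ∈ T, tailFactor K' τ q d t v) * ∏ v ∈ Tᶜ, frozenFactor K c τ q d t v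
  have hint : ∀ d T, Integrable (E.indicator (G d T)) := fun d T => by
    refine integrable_indicator_of_bounded (C := M ^ T.card * M ^ Tᶜ.card)
      ((Finset.measurable_prod _ fun v _ => measurable_tailFactor hK τ q d v).mul
        (Finset.measurable_prod _ fun v _ => measurable_frozenFactor hK τ q d v)) hE
      (fun t ht i _ => ht.1.1 i) fun t => ?_
    rw [abs_mul]
    exact mul_le_mul (abs_prod_le_pow_card (abs_tailFactor_le hK τ q d t) T)
      (abs_prod_le_pow_card (abs_frozenFactor_le hK τ q d t) Tᶜ) (abs_nonneg _) (by positivity)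
  have hexp : ∀ d, ∫ t, E.indicator (fun t => ∏ v, K (d v) (d (τ v)) (t v - t (τ v))) t =
      ∑ T : Finset V, ∫ t, E.indicator (G d T) t := by
    intro d
    rw [← integral_finsetSum _ fun T _ => hint d T]
    congr 1 with t
    by_cases ht : t ∈ E
    · simp only [Set.indicator_of_mem ht, G]
      rw [← Fintype.prod_add]
      exact Finset.prod_congr rfl fun v _ =>
        kernel_eq_frozenFactor_add_tailFactor hK τ q d ht.2 v
    · simp [Set.indicator_of_notMem ht]
  have hfrozen : ∑ d : V → Fin 2, ∫ t, E.indicator (G d ∅) t = 0 := by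
    rw [← sum_integral_frozen_eq_zero hK τ q hu (E := E) fun ρ hρ t =>
      ⟨fun h => ?_, comp_mem_clusterSet_inter_aboveSet ρ hρ⟩]
    · simp [G]
    · have := comp_mem_clusterSet_inter_aboveSet ρ⁻¹ (fun v => by
        rw [← hρ, ← Equiv.Perm.mul_apply, mul_inv_cancel, Equiv.Perm.one_apply]) h
      rwa [Function.comp_assoc, ← Equiv.Perm.coe_mul, mul_inv_cancel, Equiv.Perm.coe_one,
        Function.comp_id] at this
  simp only [hexp]
  rw [Finset.sum_comm, ← Finset.add_sum_erase _ _ (Finset.mem_univ ∅), hfrozen, zero_add]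
  set B := 2 * M ^ Fintype.card V * ((b - a) * (2 * α) ^ (Fintype.card V - 2)) with hB
  have hB0 : 0 ≤ B := by
    have := sub_nonneg.2 hab
    positivity
  calc _ ≤ ∑ T ∈ Finset.univ.erase (∅ : Finset V), ∑ _d : V → Fin 2, B := by
        refine (Finset.abs_sum_le_sum_abs _ _).trans (Finset.sum_le_sum fun T hT => ?_)
        refine (Finset.abs_sum_le_sum_abs _ _).trans (Finset.sum_le_sum fun d _ => ?_)
        exact abs_integral_mixed_prod_le hK τ q hab hα d
          (Finset.nonempty_iff_ne_empty.2 (Finset.ne_of_mem_erase hT))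
    _ ≤ ∑ T : Finset V, ∑ _d : V → Fin 2, B :=
        Finset.sum_le_sum_of_subset_of_nonneg (Finset.erase_subset _ _) fun _ _ _ =>
          Finset.sum_nonneg fun _ _ => hB0
    _ = _ := by
        simp only [Finset.sum_const, Finset.card_univ, Fintype.card_finset, Fintype.card_fun,
          Fintype.card_fin, nsmul_eq_mul, Nat.cast_pow, Nat.cast_ofNat, hB]
        rw [show (4 : ℝ) ^ Fintype.card V = 2 ^ Fintype.card V * 2 ^ Fintype.card V by
          rw [← mul_pow]; norm_num]
        ring

/-- The contribution of the configurations where the two groups interlace. -/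
theorem abs_integral_interlaced_le (hK : SelfDualKernel K K' c M) (τ : Equiv.Perm V)
    (p : V → Prop) [DecidablePred p] {u w : V} (hu : p u) (hw : ¬ p w) {a b α : ℝ} (hab : a ≤ b)
    (hα : 0 ≤ α) (d : V → Fin 2) :
    |∫ t, (clusterSet p a b α \ (aboveSet p ∪ aboveSet fun v => ¬ p v)).indicator
      (fun t => ∏ v, K (d v) (d (τ v)) (t v - t (τ v))) t| ≤
      4 * α * M ^ Fintype.card V * ((b - a) * (2 * α) ^ (Fintype.card V - 2)) := by
  have hM := hK.pos
  have hbd : ∀ t : V → ℝ, |∏ v, K (d v) (d (τ v)) (t v - t (τ v))| ≤ M ^ Fintype.card V :=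
    fun t => abs_prod_le_pow_card (fun v => hK.bdd _ _ _) Finset.univ
  refine abs_integral_indicator_le (p := p) (e := u) (w := w) (by simp [hu, hw]) hab hα
    (by positivity) ((measurableSet_clusterSet p a b α).diff
      ((measurableSet_aboveSet _).union (measurableSet_aboveSet _))) Set.sdiff_subset
    (Finset.measurable_prod _ fun v _ => (hK.measurable _ _).comp
      ((measurable_pi_apply v).sub (measurable_pi_apply (τ v)))) hbd fun t => ?_
  set J := (fun (y : ℝ) i => t i + if p i ↔ p u then 0 else y) ⁻¹'
    (clusterSet p a b α \ (aboveSet p ∪ aboveSet fun v => ¬ p v))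
  have hJ : J ⊆ Set.Icc (t u - t w - 2 * α) (t u - t w + 2 * α) := by
    rintro y ⟨⟨-, h1⟩, h2⟩
    rw [Set.mem_union, not_or] at h2
    obtain ⟨h2, h3⟩ := h2
    simp only [aboveSet, Set.mem_ofPred_eq, not_forall, not_lt, not_not, exists_prop] at h2 h3
    obtain ⟨i, j, hi, hj, hij⟩ := h2
    obtain ⟨i', j', hi', hj', hij'⟩ := h3
    have a1 := h1 u i (by simp [hu, hi])
    have a2 := h1 j w (by simp [hj, hw])
    have a3 := h1 j' u (by simp [hu, hj'])
    have a4 := h1 w i' (by simp [hi', hw])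
    simp only [hu, hw, hi, hj, hi', hj', if_true, if_false, iff_true] at a1 a2 a3 a4 hij hij'
    constructor <;> linarith
  have hvol : volume J ≤ ENNReal.ofReal (4 * α) := by
    refine (measure_mono hJ).trans (le_of_eq ?_)
    rw [Real.volume_Icc]
    congr 1
    ring
  have hlt : volume J < ⊤ := hvol.trans_lt ENNReal.ofReal_lt_top
  refine (norm_setIntegral_le_of_norm_le_const (C := M ^ Fintype.card V) hlt fun y _ =>
    (Real.norm_eq_abs _).trans_le (hbd _)).trans ?_
  rw [mul_comm]
  refine mul_le_mul_of_nonneg_right ?_ (by positivity)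
  exact ENNReal.toReal_le_of_le_ofReal (by positivity) hvol

theorem abs_sum_integral_cluster_le (hK : SelfDualKernel K K' c M) (τ : Equiv.Perm V)
    (p : V → Prop) [DecidablePred p] {u : V} (hu : ¬(p u ↔ p (τ u))) {a b α : ℝ} (hab : a ≤ b)
    (hα : 0 ≤ α) :
    |∑ d : V → Fin 2, ∫ t, (clusterSet p a b α).indicator
      (fun t => ∏ v, K (d v) (d (τ v)) (t v - t (τ v))) t| ≤
      (16 * M) ^ Fintype.card V * (max 1 α ^ (Fintype.card V - 1) * (b - a)) := by
  have hM := hK.pos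
  obtain ⟨v, w, hv, hw⟩ : ∃ v w, p v ∧ ¬ p w := by
    by_cases h : p u
    · exact ⟨u, τ u, h, by tauto⟩
    · exact ⟨τ u, u, by tauto, h⟩
  have hcard : 1 < Fintype.card V := Fintype.one_lt_card_iff.2 ⟨v, w, fun h => hw (h ▸ hv)⟩
  have habove := abs_sum_integral_above_le hK τ p hu hab hα
  have hbelow := abs_sum_integral_above_le hK τ (fun v => ¬ p v)
    (fun h => hu (not_iff_not.1 h)) hab hα
  rw [clusterSet_not] at hbelow
  set A := clusterSet p a b α
  have hA : MeasurableSet A := measurableSet_clusterSet p a b α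
  have hR := measurableSet_aboveSet p
  have hR' := measurableSet_aboveSet fun v => ¬ p v
  set R := aboveSet p
  set R' := aboveSet fun v => ¬ p v
  have hdisj : ∀ t, t ∈ R → t ∉ R' := fun t h h' =>
    lt_asymm (h v w hv hw) (h' w v hw (not_not.2 hv))
  have hint : ∀ (d : V → Fin 2) (S : Set (V → ℝ)), MeasurableSet S → S ⊆ A →
      Integrable (S.indicator fun t => ∏ v, K (d v) (d (τ v)) (t v - t (τ v))) :=
    fun d S hS hSA => integrable_indicator_of_bounded
      (Finset.measurable_prod _ fun v _ => (hK.measurable _ _).comp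
        ((measurable_pi_apply v).sub (measurable_pi_apply (τ v)))) hS
      (fun t ht i _ => (hSA ht).1 i)
      fun t => abs_prod_le_pow_card (fun v => hK.bdd _ _ _) Finset.univ
  have hsplit : ∀ d : V → Fin 2,
      ∫ t, A.indicator (fun t => ∏ v, K (d v) (d (τ v)) (t v - t (τ v))) t =
      (∫ t, (A ∩ R).indicator (fun t => ∏ v, K (d v) (d (τ v)) (t v - t (τ v))) t) +
      (∫ t, (A ∩ R').indicator (fun t => ∏ v, K (d v) (d (τ v)) (t v - t (τ v))) t) +
      ∫ t, (A \ (R ∪ R')).indicator (fun t => ∏ v, K (d v) (d (τ v)) (t v - t (τ v))) t := by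
    intro d
    have i1 := hint d _ (hA.inter hR) Set.inter_subset_left
    have i2 := hint d _ (hA.inter hR') Set.inter_subset_left
    have i3 := hint d _ (hA.diff (hR.union hR')) Set.sdiff_subset
    refine Eq.trans ?_ ((integral_add (i1.add i2) i3).trans (congrArg (· + _) (integral_add i1 i2)))
    congr 1 with t
    have := hdisj t
    by_cases h1 : t ∈ A <;> by_cases h2 : t ∈ R <;> by_cases h3 : t ∈ R' <;>
      simp_all [Set.indicator]
  simp only [hsplit, Finset.sum_add_distrib]
  have hmid : |∑ d : V → Fin 2, ∫ t, (A \ (R ∪ R')).indicator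
      (fun t => ∏ v, K (d v) (d (τ v)) (t v - t (τ v))) t| ≤ 2 ^ Fintype.card V *
      (4 * α * M ^ Fintype.card V * ((b - a) * (2 * α) ^ (Fintype.card V - 2))) := by
    refine (Finset.abs_sum_le_sum_abs _ _).trans
      ((Finset.sum_le_sum fun d _ => abs_integral_interlaced_le hK τ p hv hw hab hα d).trans ?_)
    simp
  refine (abs_add_le _ _).trans ((add_le_add ((abs_add_le _ _).trans (add_le_add habove hbelow))
    hmid).trans ?_)
  obtain ⟨n, hn⟩ : ∃ n, Fintype.card V = n + 2 := ⟨Fintype.card V - 2, by omega⟩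
  rw [hn, show n + 2 - 2 = n by omega, show n + 2 - 1 = n + 1 by omega]
  have hba := sub_nonneg.2 hab
  have h1 : (2 * α) ^ n ≤ 2 ^ n * max 1 α ^ n := by
    rw [mul_pow]
    gcongr
    exact le_max_right _ _
  have hm1 : 1 ≤ max 1 α := le_max_left _ _
  have hm2 : α ≤ max 1 α := le_max_right _ _
  set m := max 1 α
  have h2 : (2 : ℝ) ^ n ≤ 4 ^ n := by gcongr; norm_num
  have hmn : (0 : ℝ) ≤ m ^ n := by positivity
  calc _ = (4 * 4 ^ (n + 2) + 4 * α * 2 ^ (n + 2)) * M ^ (n + 2) * (b - a) * (2 * α) ^ n := by ring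
    _ ≤ (4 * 4 ^ (n + 2) * m + 4 * m * 4 ^ (n + 2)) * M ^ (n + 2) * (b - a) * (2 ^ n * m ^ n) := by
        gcongr ?_ * _ * _ * ?_
        refine add_le_add (le_mul_of_one_le_right (by positivity) hm1) ?_
        gcongr
        norm_num
    _ = 128 * (8 : ℝ) ^ n * (M ^ (n + 2) * m ^ (n + 1) * (b - a)) := by
        rw [show (8 : ℝ) = 4 * 2 by norm_num, mul_pow]
        ring
    _ ≤ 16 ^ (n + 2) * (M ^ (n + 2) * m ^ (n + 1) * (b - a)) := by
        refine mul_le_mul_of_nonneg_right ?_ (by positivity)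
        have : (8 : ℝ) ^ n ≤ 16 ^ n := by gcongr; norm_num
        rw [pow_add]
        nlinarith [pow_pos (show (0 : ℝ) < 16 by norm_num) n]
    _ = _ := by
        rw [mul_pow]
        ring

end Assembly

theorem iff_of_iff_finRotate {r : ℕ} {f : Fin r → Prop} (hf : ∀ j, f j ↔ f (finRotate r j))
    (i j : Fin r) : f i ↔ f j := by
  cases r with
  | zero => exact i.elim0
  | succ n =>
    have h : ∀ m (hm : m < n + 1), f ⟨m, hm⟩ ↔ f 0 := by
      intro m
      induction m with
      | zero => exact fun _ => Iff.rfl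
      | succ m ih =>
        intro hm
        rw [← ih (by omega), hf ⟨m, by omega⟩, finRotate_of_lt (by omega)]
    exact (h i i.2).trans (h j j.2).symm

theorem exists_perm_of_blocks {ι V : Type*} {P : ι → Finset V}
    (hdisj : ∀ i j, i ≠ j → Disjoint (P i) (P j)) (hcover : ∀ v, ∃ i, v ∈ P i)
    (π : ∀ i, Equiv.Perm {x // x ∈ P i}) :
    ∃ τ : Equiv.Perm V, ∀ i (x : {x // x ∈ P i}), τ x = π i x := by
  let f : (Σ i, {x // x ∈ P i}) → V := fun z => z.2
  have hf : Function.Bijective f := by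
    refine ⟨?_, fun v => ?_⟩
    · rintro ⟨i, x, hx⟩ ⟨j, y, hy⟩ h
      obtain rfl : x = y := h
      obtain rfl : i = j := by
        by_contra hij
        exact Finset.disjoint_left.1 (hdisj i j hij) hx hy
      rfl
    · obtain ⟨i, hi⟩ := hcover v
      exact ⟨⟨i, v, hi⟩, rfl⟩
  let Θ := Equiv.ofBijective f hf
  refine ⟨(Θ.symm.trans (Equiv.sigmaCongrRight π)).trans Θ, fun i x => ?_⟩
  have : Θ.symm x = ⟨i, x⟩ := Θ.symm_apply_eq.2 rfl
  simp only [Equiv.trans_apply, this]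
  rfl

/-- The cyclic successor in the increasing enumeration of `S`. -/
noncomputable def cyclicSucc {n : ℕ} (S : Finset (Fin n)) : Equiv.Perm {x // x ∈ S} :=
  ((S.orderIsoOfFin rfl).symm.toEquiv.trans (finRotate S.card)).trans
    (S.orderIsoOfFin rfl).toEquiv

theorem cyclicSucc_orderIsoOfFin {n : ℕ} (S : Finset (Fin n)) (j : Fin S.card) :
    cyclicSucc S (S.orderIsoOfFin rfl j) = S.orderIsoOfFin rfl (finRotate S.card j) := by
  simp [cyclicSucc]

theorem Fcyc_eq_prod {n : ℕ} {Kb : ℝ → ℝ → Matrix (Fin 2) (Fin 2) ℝ} {K : Fin 2 → Fin 2 → ℝ → ℝ}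
    (hKb : ∀ x y a b, Kb x y a b = K a b (x - y)) (S : Finset (Fin n))
    (σ : Equiv.Perm {x // x ∈ S}) {s τ : Equiv.Perm (Fin n)}
    (hs : ∀ x : {x // x ∈ S}, s x = σ⁻¹ x)
    (hτ : ∀ x : {x // x ∈ S}, τ x = (σ * cyclicSucc S * σ⁻¹) x)
    (d : Fin n → Fin 2) (t : Fin n → ℝ) :
    Fcyc n Kb S σ d t = 1 / (2 * (S.card : ℝ)) *
      ∏ v ∈ S, K (d (s v)) (d (s (τ v))) (t v - t (τ v)) := by
  have h := ((S.orderIsoOfFin rfl).toEquiv.trans σ).prod_comp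
    (fun x : {x // x ∈ S} => K (d (s x)) (d (s (τ x))) (t x - t (τ x)))
  rw [Fcyc, ← Finset.prod_coe_sort S, ← h]
  congr 1
  refine Finset.prod_congr rfl fun j _ => ?_
  rw [hKb, hτ, hs, hs]
  simp [cyclicSucc_orderIsoOfFin]

theorem chiInd_mul_chiInd {k : ℕ} (h₁ : ∀ i : Fin k, i.val < 2 * k)
    (h₂ : ∀ i : Fin k, k + i.val < 2 * k) (a b α : ℝ) (t : Fin (2 * k) → ℝ)
    (ht : t ∈ Set.univ.pi fun _ : Fin (2 * k) => Set.Icc a b) :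
    chiInd (Set.Icc a b) α (fun i : Fin k => t ⟨i.val, h₁ i⟩) *
      chiInd (Set.Icc a b) α (fun i : Fin k => t ⟨k + i.val, h₂ i⟩) =
      (clusterSet (fun i : Fin (2 * k) => i.val < k) a b α).indicator 1 t := by
  have ht' : ∀ i, t i ∈ Set.Icc a b := fun i => ht i trivial
  by_cases h : t ∈ clusterSet (fun i : Fin (2 * k) => i.val < k) a b α
  · rw [Set.indicator_of_mem h, chiInd, chiInd,
      if_pos ⟨fun i => ht' _, fun i j => h.2 _ _ (by simp [i.2, j.2])⟩,
      if_pos ⟨fun i => ht' _, fun i j => h.2 _ _ (by simp)⟩]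
    simp
  rw [Set.indicator_of_notMem h, chiInd, chiInd]
  by_contra hne
  have h1 : ∀ i j : Fin k, t ⟨i.val, h₁ i⟩ - t ⟨j.val, h₁ j⟩ < α := by
    by_contra h1
    simp [h1] at hne
  have h2 : ∀ i j : Fin k, t ⟨k + i.val, h₂ i⟩ - t ⟨k + j.val, h₂ j⟩ < α := by
    by_contra h2
    simp [h2] at hne
  refine h ⟨ht', fun i j hij => ?_⟩
  by_cases hi : i.val < k
  · exact h1 ⟨i, hi⟩ ⟨j, hij.1 hi⟩
  · have hj : ¬ j.val < k := fun hj => hi (hij.2 hj)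
    have := h2 ⟨i - k, by omega⟩ ⟨j - k, by omega⟩
    simp only [Nat.add_sub_cancel' (not_lt.1 hi), Nat.add_sub_cancel' (not_lt.1 hj)] at this
    exact this

theorem abs_sum_setIntegral_prod_Fcyc_le {Kb : ℝ → ℝ → Matrix (Fin 2) (Fin 2) ℝ}
    {K K' : Fin 2 → Fin 2 → ℝ → ℝ} {c M : ℝ} (hK : SelfDualKernel K K' c M)
    (hKb : ∀ x y a b, Kb x y a b = K a b (x - y)) {k m : ℕ} (h₁ : ∀ i : Fin k, i.val < 2 * k)
    (h₂ : ∀ i : Fin k, k + i.val < 2 * k) {P : Fin m → Finset (Fin (2 * k))}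
    (hne : ∀ i, (P i).Nonempty) (hdisj : ∀ i j, i ≠ j → Disjoint (P i) (P j))
    (hcover : Finset.univ.biUnion P = (Finset.univ : Finset (Fin (2 * k))))
    (hmix : ∃ i₀, (∃ j ∈ P i₀, (j : ℕ) < k) ∧ (∃ j ∈ P i₀, k ≤ (j : ℕ)))
    (σ : (i : Fin m) → Equiv.Perm {x // x ∈ P i}) {a b : ℝ} (hab : a ≤ b) {α : ℝ} (hα : 0 ≤ α) :
    |∑ d : Fin (2 * k) → Fin 2,
        ∫ t in (Set.univ.pi fun _ : Fin (2 * k) => Set.Icc a b),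
          (∏ i : Fin m, Fcyc (2 * k) Kb (P i) (σ i) d t) *
            chiInd (Set.Icc a b) α (fun i : Fin k => t ⟨i.val, h₁ i⟩) *
            chiInd (Set.Icc a b) α (fun i : Fin k => t ⟨k + i.val, h₂ i⟩)|
      ≤ (16 * M) ^ (2 * k) * (max 1 α ^ (2 * k - 1) * (b - a)) := by
  have hcover' : ∀ v, ∃ i, v ∈ P i := fun v => by
    simpa using hcover.symm.le (Finset.mem_univ v)
  obtain ⟨s, hs⟩ := exists_perm_of_blocks hdisj hcover' fun i => (σ i)⁻¹
  obtain ⟨τ, hτ⟩ := exists_perm_of_blocks hdisj hcover' fun i => σ i * cyclicSucc (P i) * (σ i)⁻¹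
  let p : Fin (2 * k) → Prop := fun i => i.val < k
  have hcross : ∃ u, ¬(p u ↔ p (τ u)) := by
    by_contra! hcon
    obtain ⟨i, ⟨x, hx, hxk⟩, y, hy, hyk⟩ := hmix
    let o := (P i).orderIsoOfFin rfl
    have hf := iff_of_iff_finRotate (f := fun j => p (σ i (o j))) fun j => by
      rw [hcon, hτ]
      simp [o, cyclicSucc_orderIsoOfFin]
    have h := hf (o.symm ((σ i)⁻¹ ⟨x, hx⟩)) (o.symm ((σ i)⁻¹ ⟨y, hy⟩))
    simp [p] at h
    omega
  obtain ⟨u, hu⟩ := hcross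
  set w : ℝ := ∏ i, 1 / (2 * ((P i).card : ℝ))
  have hw0 : 0 ≤ w := Finset.prod_nonneg fun i _ => by positivity
  have hw1 : w ≤ 1 := Finset.prod_le_one (fun i _ => by positivity) fun i _ => by
    have : (1 : ℝ) ≤ (P i).card := by exact_mod_cast (hne i).card_pos
    rw [div_le_one (by positivity)]
    linarith
  have hA := measurableSet_clusterSet p a b α
  have hint : ∀ d : Fin (2 * k) → Fin 2,
      ∫ t in (Set.univ.pi fun _ : Fin (2 * k) => Set.Icc a b),
        (∏ i : Fin m, Fcyc (2 * k) Kb (P i) (σ i) d t) *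
          chiInd (Set.Icc a b) α (fun i : Fin k => t ⟨i.val, h₁ i⟩) *
          chiInd (Set.Icc a b) α (fun i : Fin k => t ⟨k + i.val, h₂ i⟩) =
      w * ∫ t, (clusterSet p a b α).indicator
        (fun t => ∏ v, K (d (s v)) (d (s (τ v))) (t v - t (τ v))) t := by
    intro d
    rw [← integral_indicator (MeasurableSet.univ_pi fun _ => measurableSet_Icc),
      ← integral_const_mul]
    congr 1 with t
    by_cases ht : t ∈ Set.univ.pi fun _ : Fin (2 * k) => Set.Icc a b
    · rw [Set.indicator_of_mem ht, mul_assoc, chiInd_mul_chiInd h₁ h₂ a b α t ht]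
      have hprod : ∏ i : Fin m, Fcyc (2 * k) Kb (P i) (σ i) d t =
          w * ∏ v, K (d (s v)) (d (s (τ v))) (t v - t (τ v)) := by
        rw [← hcover, Finset.prod_biUnion fun i _ j _ hij => hdisj i j hij,
          ← Finset.prod_mul_distrib]
        exact Finset.prod_congr rfl fun i _ => Fcyc_eq_prod hKb (P i) (σ i) (hs i) (hτ i) d t
      rw [hprod]
      by_cases h : t ∈ clusterSet p a b α
      · rw [Set.indicator_of_mem h, Set.indicator_of_mem h, Pi.one_apply, mul_one]
      · rw [Set.indicator_of_notMem h, Set.indicator_of_notMem h, mul_zero, mul_zero]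
    · rw [Set.indicator_of_notMem ht, Set.indicator_of_notMem fun h => ht fun i _ => h.1 i,
        mul_zero]
  have hmain := abs_sum_integral_cluster_le hK τ p hu hab hα
  rw [Fintype.card_fin] at hmain
  simp only [hint]
  rw [← Finset.mul_sum, abs_mul, abs_of_nonneg hw0]
  refine (mul_le_of_le_one_left (abs_nonneg _) hw1).trans (le_trans (le_of_eq ?_) hmain)
  congr 1
  exact (s.symm.arrowCongr (Equiv.refl (Fin 2))).sum_comp fun d : Fin (2 * k) → Fin 2 =>
    ∫ t, (clusterSet p a b α).indicator (fun t => ∏ v, K (d v) (d (τ v)) (t v - t (τ v))) t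

/-- Main Estimate: For each `β ∈ {1,4}`, i.e. for each of the two matrix
kernels `K₁, K₄`, there is a constant `C > 0`, uniform in all the remaining data, such
that for all positive integers `k, N`, every `m ∈ {1,…,2k}`, every partition
`P₁,…,P_m` of `{1,…,2k}` into nonempty blocks, at least one of which meets both
`{1,…,k}` and `{k+1,…,2k}` (the mixing property), all bijections `σᵢ` of the blocks,
every bounded interval `A = [a,b]` with `|A| = b − a ≥ 1` and every `α > 0`:
`|Σ_{d ∈ {1,2}^{2k}} ∫_{A^{2k}} (∏ᵢ F_{Pᵢ,σᵢ}^{K_β}(d,t)) χ_α(t₁,…,t_k)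
χ_α(t_{k+1},…,t_{2k}) dt| ≤ C^k · max(1,α)^{2k−1} · |A|`. -/
theorem main_estimate :
    ∀ Kb ∈ ({K1mat, K4mat} : Set (ℝ → ℝ → Matrix (Fin 2) (Fin 2) ℝ)),
      ∃ C > 0, ∀ (k N m : ℕ), 0 < k → 0 < N → 1 ≤ m → m ≤ 2 * k →
        ∀ P : Fin m → Finset (Fin (2 * k)),
          (∀ i, (P i).Nonempty) →
          (∀ i j, i ≠ j → Disjoint (P i) (P j)) →
          (Finset.univ.biUnion P = (Finset.univ : Finset (Fin (2 * k)))) →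
          (∃ i₀, (∃ j ∈ P i₀, (j : ℕ) < k) ∧ (∃ j ∈ P i₀, k ≤ (j : ℕ))) →
        ∀ σ : (i : Fin m) → Equiv.Perm {x // x ∈ P i},
        ∀ a b : ℝ, 1 ≤ b - a → ∀ α : ℝ, 0 < α →
          |∑ d : Fin (2 * k) → Fin 2,
              ∫ t in (Set.univ.pi fun _ : Fin (2 * k) => Set.Icc a b),
                (∏ i : Fin m, Fcyc (2 * k) Kb (P i) (σ i) d t) *
                  chiInd (Set.Icc a b) α (fun i : Fin k => t ⟨i.val, by omega⟩) *
                  chiInd (Set.Icc a b) α (fun i : Fin k => t ⟨k + i.val, by omega⟩)|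
            ≤ C ^ k * (max 1 α) ^ (2 * k - 1) * (b - a) := by
  intro Kb hKb
  obtain ⟨K, K', c, M, hK, hKb⟩ : ∃ K K' c M, SelfDualKernel K K' c M ∧
      ∀ x y a b, Kb x y a b = K a b (x - y) := by
    rcases hKb with rfl | rfl
    · exact exists_selfDualKernel_K1mat
    · exact exists_selfDualKernel_K4mat
  have hM := hK.pos
  refine ⟨(16 * M) ^ 2, by positivity, ?_⟩
  intro k N m _ _ _ _ P hne hdisj hcover hmix σ a b hab α hα
  rw [← pow_mul, mul_assoc]
  exact abs_sum_setIntegral_prod_Fcyc_le hK hKb _ _ hne hdisj hcover hmix σ (by linarith)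
    hα.le
end
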